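/- The stribolic constant satisfies the bounds 0.2788770612338 < κ_{23} − 1 + κ_{23}/κ_{22} < κ < κ_{23} < 0.2788770613941, where κ := inf_{n≥0} κ_n. -/

import Mathlib

open Set MeasureTheory Polynomial

noncomputable section

/-- The class `E` of antitone functions `g : [0,1] → [0,1]` with `g 0 = 1` and
positive integral (functions are modelled as total functions `ℝ → ℝ`,
constrained on `[0,1]`). -/
def E : Set (ℝ → ℝ) :=
  {g | AntitoneOn g (Icc 0 1) ∧ MapsTo g (Icc 0 1) (Icc 0 1) ∧ g 0 = 1 ∧
    0 < ∫ x in (0:ℝ)..1, g x}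

/-- The pseudo-inverse `g*` of `g`, given by `g* y = sup {x ∈ [0,1] | g x ≥ y}`. -/
def pseudoInv (g : ℝ → ℝ) : ℝ → ℝ := fun y => sSup {x | x ∈ Icc (0:ℝ) 1 ∧ y ≤ g x}

/-- The stribolic operator `T`, `(T g) x = (∫_x^1 g*) / (∫_0^1 g)`. -/
def T (g : ℝ → ℝ) : ℝ → ℝ := fun x =>
  (∫ t in x..(1:ℝ), pseudoInv g t) / (∫ t in (0:ℝ)..1, g t)

/-- The canonical stribolic iterates: `h 0 = 1` and `h (n+1) = T (h n)`. -/
def h : ℕ → ℝ → ℝ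
  | 0 => fun _ => 1
  | n + 1 => T (h n)

/-- `κ n = ∫_0^1 h n`. -/
def κ (n : ℕ) : ℝ := ∫ t in (0:ℝ)..1, h n t

/-- The compositions `q n = h n ∘ ⋯ ∘ h 1`, with `q 0 = id`. -/
def q : ℕ → ℝ → ℝ
  | 0 => fun x => x
  | n + 1 => h (n + 1) ∘ q n

/-- `q (n-1)`, with the convention that for `n = 0` (i.e. "`q (-1)`") it is the
constant function `1` (the only convention making the `n = 0` cases hold). -/
def qprev : ℕ → ℝ → ℝ
  | 0 => fun _ => 1
  | n + 1 => q n

/-- `Q n x = ∫_0^x (q n)' (t) * q (n-1) (t) dt`. -/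
def Q (n : ℕ) (x : ℝ) : ℝ := ∫ t in (0:ℝ)..x, deriv (q n) t * qprev n t

/-! ### A kernel-evaluated checker for polynomial approximations of the compositions `q n` -/

/-- Binary trees of integer coefficients: `node k l r` stands for `l + X ^ k * r`. -/
inductive CoeffTree where
  | leaf (c : ℤ) : CoeffTree
  | node (k : ℕ) (l r : CoeffTree) : CoeffTree

namespace CoeffTree

/-- `f x`, with the kernel made to evaluate `x` first. -/
def force {α : Type} (x : ℕ) (f : ℕ → α) : α :=
  Nat.rec (motive := fun _ => α) (f 0) (fun n _ => f (Nat.succ n)) x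

/-- `f x`, with the kernel made to evaluate the integer `x` first. -/
def forceZ {α : Type} (x : ℤ) (f : ℤ → α) : α :=
  Int.rec (motive := fun _ => α) (fun n => force n fun n => f (Int.ofNat n))
    (fun n => force n fun n => f (Int.negSucc n)) x

/-- `x * 2 ^ n`. -/
def shl (x : ℤ) (n : ℕ) : ℤ :=
  Int.rec (motive := fun _ => ℤ) (fun a => Int.ofNat (Nat.shiftLeft a n))
    (fun a => Int.negSucc (Nat.pred (Nat.shiftLeft (Nat.succ a) n))) x

/-- `⌊x / 2 ^ n⌋`. -/
def shr (x : ℤ) (n : ℕ) : ℤ :=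
  Int.rec (motive := fun _ => ℤ) (fun a => Int.ofNat (Nat.shiftRight a n))
    (fun a => Int.negSucc (Nat.shiftRight a n)) x

/-- `m ^ k`. -/
def mpow (m : ℤ) (k : ℕ) : ℤ :=
  Int.rec (motive := fun _ => ℤ) (fun a => Int.ofNat (Nat.pow a k))
    (fun a => Bool.rec (motive := fun _ => ℤ) (Int.neg (Int.ofNat (Nat.pow (Nat.succ a) k)))
      (Int.ofNat (Nat.pow (Nat.succ a) k)) (Nat.beq (Nat.mod k 2) 0)) m

/-- The value of the polynomial at `2 ^ W`. -/
def pack (W : ℕ) (t : CoeffTree) : ℤ :=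
  CoeffTree.rec (motive := fun _ => ℤ) (fun c => c)
    (fun k _ _ x y => Int.add x (shl y (Nat.mul W k))) t

/-- The value of `∑ (i + j) c_j X ^ j` at `2 ^ W`. -/
def derivPack (W : ℕ) (t : CoeffTree) : ℕ → ℤ :=
  CoeffTree.rec (motive := fun _ => ℕ → ℤ) (fun c i => Int.mul (Int.ofNat i) c)
    (fun k _ _ x y i => Int.add (x i) (shl (y (Nat.add i k)) (Nat.mul W k))) t

/-- The sum of the absolute values of the coefficients. -/
def l1 (t : CoeffTree) : ℕ :=
  CoeffTree.rec (motive := fun _ => ℕ) (fun c => Int.natAbs c) (fun _ _ _ x y => Nat.add x y) t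

/-- The sum of the `(i + j) |c_j|`. -/
def derivL1 (t : CoeffTree) : ℕ → ℕ :=
  CoeffTree.rec (motive := fun _ => ℕ → ℕ) (fun c i => Nat.mul i (Int.natAbs c))
    (fun k _ _ x y i => Nat.add (x i) (y (Nat.add i k))) t

/-- A rounded value of the polynomial at `m / 4096`. -/
def ev (m : ℤ) (t : CoeffTree) : ℤ :=
  CoeffTree.rec (motive := fun _ => ℤ) (fun c => c)
    (fun k _ _ x y => Int.add x (shr (Int.mul y (mpow m k)) (Nat.mul 12 k))) t

/-- `2 ^ d` copies of `2 ^ (W - 1)`, packed with width `W`. -/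
def offset (W : ℕ) (d : ℕ) : ℕ :=
  Nat.rec (motive := fun _ => ℕ) (Nat.pow 2 (Nat.pred W))
    (fun d x => Nat.add x (Nat.shiftLeft x (Nat.mul W (Nat.pow 2 d)))) d

/-- `|a - b|`. -/
def absDiff (a b : ℕ) : ℕ := Nat.add (Nat.sub a b) (Nat.sub b a)

/-- A bound on `[-ρ / 4096, ρ / 4096]` for the polynomial whose coefficients, shifted by `H`, are
packed in `v`. -/
def hb (W H ρ d : ℕ) : ℕ → ℕ :=
  Nat.rec (motive := fun _ => ℕ → ℕ) (fun v => absDiff v H)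
    (fun d f v => force (Nat.mul W (Nat.pow 2 d)) fun n => force (Nat.shiftRight v n) fun h =>
      force (Nat.sub v (Nat.shiftLeft h n)) fun l =>
      Nat.succ (Nat.add (f l) (Nat.shiftRight (Nat.mul (f h) (Nat.pow ρ (Nat.pow 2 d)))
        (Nat.mul 12 (Nat.pow 2 d))))) d

/-- The coefficient of the next polynomial obtained from the packed coefficient `v`. -/
def qt (H K i v : ℕ) : ℤ :=
  Bool.rec (motive := fun _ => ℤ) (Int.ofNat (Nat.div (Nat.sub H v) (Nat.mul K i)))
    (Int.neg (Int.ofNat (Nat.div (Nat.sub v H) (Nat.mul K i)))) (Nat.ble H v)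

/-- Builds the tree of the next polynomial from packed coefficients and passes it to a continuation. -/
def mk {α : Type} (W H K d : ℕ) : ℕ → ℕ → (CoeffTree → α) → α :=
  Nat.rec (motive := fun _ => ℕ → ℕ → (CoeffTree → α) → α) (fun i v f => forceZ (qt H K i v) fun c => f (leaf c))
    (fun d g i v f => force (Nat.pow 2 d) fun e => force (Nat.mul W e) fun n =>
      force (Nat.shiftRight v n) fun h =>
      force (Nat.sub v (Nat.shiftLeft h n)) fun l =>
      g i l fun t => g (Nat.add i e) h fun s => f (node e t s)) d

end CoeffTree

/-- Certificate for one step: the constant, the constant coefficient of the new polynomial, the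
packing width, the depth of the coefficient tree, the window and the claimed error bounds. -/
structure Cert where
  K : ℕ
  c : ℤ
  W : ℕ
  d : ℕ
  L : ℕ
  R : ℕ
  G : ℕ
  η : ℕ

/-- State of the checker: two consecutive polynomials (constant coefficient `a`, other coefficients
`ta`), bounds for their errors and for those of their derivatives, and the window. -/
structure StepState where
  a : ℤ
  ta : CoeffTree
  b : ℤ
  tb : CoeffTree
  eA : ℕ
  eB : ℕ
  ηA : ℕ
  ηB : ℕ
  L : ℕ
  R : ℕ

namespace CoeffTree

/-- Scaling factor of the fixed-point arithmetic. -/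
def one : ℕ := Nat.pow 2 200

/-- A rounded value of `a + X * t` at `m / 4096`. -/
def eval (m a : ℤ) (t : CoeffTree) : ℤ := Int.add a (shr (Int.mul (ev m t) m) 12)

/-- Decides `0 ≤ x`. -/
def nonneg (x : ℤ) : Bool :=
  Int.rec (motive := fun _ => Bool) (fun _ => true) (fun _ => false) x

/-- Subtraction. -/
def sub (x y : ℤ) : ℤ := Int.add x (Int.neg y)

/-- Sum of three numbers. -/
def add3 (x y z : ℕ) : ℕ := Nat.add x (Nat.add y z)

/-- Bound for the part of the residual of degree at least `e`. -/
def tailBound (W H ρ d e V : ℕ) : ℕ :=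
  Nat.succ (Nat.shiftRight (Nat.succ (Nat.shiftRight (Nat.mul (hb W H ρ d V) (Nat.pow ρ e))
    (Nat.mul 12 e))) 200)

/-- The error bounds claimed by a certificate, checked at the two ends of the window. -/
def finalCheck (S : StepState) (k : Cert) (res : ℕ) (Au Av Bu Bv Cu Cv : ℤ) : Bool :=
  let dA := Nat.add (Int.natAbs (sub (Int.ofNat one) Au)) 1024
  let A := Nat.add (Int.natAbs Av) 1024
  let B := Nat.add (Int.natAbs Bu) 1024
  let dB := Nat.add (Int.natAbs (sub (Int.ofNat one) Bv)) 1024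
  and (Nat.ble (add3
    (add3 S.eA S.eB (Nat.shiftRight (Nat.mul (Nat.mul 2 S.eB) (add3 dA A S.ηA)) 200))
    (add3 (Nat.shiftRight (Nat.mul (Nat.add dA S.eA) (Nat.add B S.eB)) 200)
      (Nat.shiftRight (Nat.mul (Nat.add dB S.eB) (Nat.add A S.eA)) 200)
      (Nat.shiftRight (Int.natAbs (sub (Int.mul (Int.ofNat k.K) (sub (Int.ofNat one) Cu))
        (Int.mul (Int.ofNat one) Bu))) 200))
    (add3 (Int.natAbs Cv) res 10000)) k.G)
  (and (Nat.ble (Nat.add (Nat.mul 8 S.ηB) (Nat.mul 4 res)) k.η)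
  (and (nonneg (sub Cv (Int.ofNat (Nat.add k.η 1024))))
  (and (nonneg (sub (Int.ofNat (Nat.mul 2 one)) (Int.add Cu (Int.ofNat (Nat.add k.η 1024)))))
  (and (Nat.ble (Nat.add (Nat.mul 5 one) (Nat.mul 18 k.G)) (Nat.mul 18 k.K))
    (Nat.ble k.K one)))))

/-- One step of the checker. -/
def step (odd : Bool) (S : StepState) (k : Cert) (f : StepState → Bool) : Bool :=
  force (Nat.pow 2 (Nat.pred k.W)) fun H => force (Nat.pow 2 k.d) fun e =>
  forceZ (Int.add (Int.mul (Int.add S.a (shl (pack k.W S.ta) k.W)) (derivPack k.W S.tb 1))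
    (Int.ofNat (offset k.W (Nat.succ k.d)))) fun Z =>
  force (Int.toNat Z) fun V =>
  force (Nat.mul k.W e) fun w =>
  force (Nat.shiftRight V w) fun hi =>
  force (Nat.sub V (Nat.shiftLeft hi w)) fun lo =>
  and (nonneg Z) <|
  and (Nat.ble (Nat.succ (Nat.shiftRight hi w)) 1) <|
  and (Nat.ble 1 k.W) <|
  and (Nat.ble k.d 9) <|
  and (Nat.ble k.L S.L) <|
  and (Nat.ble k.R S.R) <|
  and (Nat.ble (Nat.succ (Nat.mul (Nat.add (Int.natAbs S.a) (l1 S.ta)) (derivL1 S.tb 1))) H) <|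
  mk k.W H k.K k.d 1 lo fun t =>
  forceZ (Bool.rec (motive := fun _ => ℤ) (Int.ofNat k.R) (Int.neg (Int.ofNat k.L)) odd) fun u =>
  forceZ (Bool.rec (motive := fun _ => ℤ) (Int.neg (Int.ofNat k.L)) (Int.ofNat k.R) odd) fun v =>
  force (Nat.add (Nat.mul e e) (tailBound k.W H (Nat.add k.L (Nat.sub k.R k.L)) k.d e hi)) fun res =>
  forceZ (eval u S.a S.ta) fun Au =>
  forceZ (eval v S.a S.ta) fun Av =>
  forceZ (eval u S.b S.tb) fun Bu =>
  forceZ (eval v S.b S.tb) fun Bv =>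
  forceZ (eval u k.c t) fun Cu =>
  forceZ (eval v k.c t) fun Cv =>
  and (finalCheck S k res Au Av Bu Bv Cu Cv)
  (f ⟨S.b, S.tb, k.c, t, S.eB, Nat.succ (Nat.div (Nat.mul 36 k.G) 5), S.ηB, k.η, k.L, k.R⟩)

/-- Checks a list of certificates. -/
def run (l : List Cert) : Bool → StepState → Bool :=
  List.rec (motive := fun _ => Bool → StepState → Bool) (fun _ _ => true)
    (fun k _ f odd S => step odd S k (f (not odd))) l

/-- The state describing `x` and `1 - x` exactly. -/
def start : StepState :=
  ⟨Int.ofNat (Nat.shiftLeft 2471 188), leaf (Int.ofNat one), Int.ofNat (Nat.shiftLeft 1625 188),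
    leaf (Int.neg (Int.ofNat one)), 0, 0, 0, 0, 2471, 1625⟩

end CoeffTree

/-- Certificates for `κ 1, …, κ 24`. -/
def certs : List Cert :=
  [⟨803469022129495137770981046170581301261101496891396417650688, 584823381608507480800474248162654436000989106283290480871444, 403, 1, 2471, 1625, 13107, 20⟩,
   ⟨535646014752996758513987364113720867507400997927597611769193, 558082438473810599282127173639292610612225949164371968000123, 405, 2, 2471, 1625, 107423, 228⟩,
   ⟨482081413277697082662588627702348780756660898134837850592897, 550595077310925936357367331731759251498013554244166275305044, 407, 3, 2471, 1625, 883251, 2084⟩,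
   ⟨459125155502568650154846312097475029292057998223655095804336, 547815767160671761254816125258725756177628528640000000013919, 411, 3, 2471, 1625, 7167330, 16932⟩,
   ⟨452302491478492018115831987529592970290340353145156724640155, 546423965197765517076410602161455696266797289546271096291277, 416, 4, 2471, 1625, 58152000, 136484⟩,
   ⟨449574210995911029549648635360085884927382160765655271206682, 546533177944257359622521011087905284024913997357571175470132, 424, 5, 2471, 1625, 471716000, 1095972⟩,
   ⟨448667666572873566473137684150842735099755739809538794029836, 545800064617539772939563390307321226073720046641526401318215, 437, 6, 2471, 1625, 3826310000, 8784164⟩,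
   ⟨448325043468905451212542557741547312114374744650276571889621, 546485067578316749776708628309738399947250303541820696985709, 458, 6, 2471, 1625, 31035800000, 70289700⟩,
   ⟨448206083514502853677408514846027354286467384133168514696920, 545573902554367913618861667809757939806158568709685831122515, 490, 7, 2471, 1625, 251727000000, 562383140⟩,
   ⟨448162369783194240421651519480082191873986715592870943881465, 546657131609159756994006714018253993368228461148104532284320, 543, 8, 2000, 1492, 52421600000000000000000000000000, 4499327268⟩,
   ⟨448146901221048254861611826096329905886834637178145210890416, 545327502373156185860814916449153445279123095212752172258516, 627, 8, 1782, 1345, 831207000000000000000000000000000, 35994880292⟩,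
   ⟨448141288874755371762066612525049106422935969554100600037570, 546944302197503935791113485630461491747113062332993929364031, 763, 9, 1472, 1215, 9857790000000000000000000000000000, 287960090916⟩,
   ⟨448139286199921844373227171116877676985316507646169606106052, 544973207525519893927382295930902774716225388283221893990003, 983, 9, 1258, 1025, 104728000000000000000000000000000000, 2303681775908⟩,
   ⟨448138563656052006116818759472695235140726215797172612410851, 547374877558417746954809253241107610674675271817409171328518, 1339, 9, 998, 889, 1055940000000000000000000000000000000, 18429455255908⟩,
   ⟨448138304873482574781184689756364977469495314439683555069141, 544448806962130901214421066524490447689331390492724046847253, 1824, 9, 835, 721, 10111700000000000000000000000000000000, 7550951598181485023032760⟩,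
   ⟨448138211738004017417670761660065885587179485893022149527760, 548014928443867541549382405168673202978769215172094501326820, 2297, 9, 651, 612, 93812500000000000000000000000000000000, 61707043860215117508689708⟩,
   ⟨448138178326645627951999402129184985245400551939215689899950, 543670747183416393775540132143320201598913708104622429898304, 2686, 9, 540, 485, 854405000000000000000000000000000000000, 1295461209854563240400869883370424⟩,
   ⟨448138166315010246411332801134267888569265831606795578175090, 548965810371485652565158333478004044188338957915406820843331, 3034, 9, 417, 406, 7767950000000000000000000000000000000000, 10363689679221361989186887937243268⟩,
   ⟨448138162002865351949432091574886792109329965483242352688911, 542516323920212088367383575888306292305631784322976866502442, 3361, 9, 345, 318, 68844900000000000000000000000000000000000, 82909538396318743994112757676297716⟩,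
   ⟨448138160453357931300840434521039827199144065192747949514216, 550378741263249161199921683461781172410837908569848830947173, 3674, 9, 266, 265, 600158000000000000000000000000000000000000, 663276307170549951962175585827548528⟩,
   ⟨448138159896912689507845598700791880935695409258167597167378, 540804008262688944818761882726318570364021407104214218988240, 3981, 9, 219, 206, 5197810000000000000000000000000000000000000, 5306210457364399616816514866823131296⟩,
   ⟨448138159697004149138474125783452851623244037775726938156514, 552479012754797981575716416980238124427859085310915285594121, 4283, 9, 168, 170, 45237200000000000000000000000000000000000000, 42449683658915196934532118934589148048⟩,
   ⟨448138159625204766239106505326055227998180173355635388199128, 538265432410420475664179422498537305039318550331721523446521, 4581, 9, 138, 131, 392739000000000000000000000000000000000000000, 339597469271321575476256951476714302996⟩,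
   ⟨448138159599412477958368186859415037072825426992152278414235, 555602698093948753417143325250958304462178594866304234375351, 4877, 9, 110, 112, 3173770000000000000000000000000000000000000000, 2716779754170572603810055611813715473096⟩]

theorem le_of_hasDerivAt_nonneg {f f' : ℝ → ℝ} {a b : ℝ} (hf : ContinuousOn f (Icc a b))
    (hd : ∀ x ∈ Ioo a b, HasDerivAt f (f' x) x) (h0 : ∀ x ∈ Ioo a b, 0 ≤ f' x)
    {x y : ℝ} (hx : a ≤ x) (hxy : x ≤ y) (hy : y ≤ b) : f x ≤ f y := by
  have := monotoneOn_of_deriv_nonneg (convex_Icc a b) hf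
    (by rw [interior_Icc]; exact fun x hx => (hd x hx).differentiableAt.differentiableWithinAt)
    (by rw [interior_Icc]; exact fun x hx => by rw [(hd x hx).deriv]; exact h0 x hx)
  exact this ⟨hx, hxy.trans hy⟩ ⟨hx.trans hxy, hy⟩ hxy

/-- One step of the recursion `C' = -A B' / k` on `[0, 1]`: the data of the functions `A`, `B`, `C`. -/
structure StepData (A B C B' : ℝ → ℝ) (k : ℝ) : Prop where
  pos : 0 < k
  anti : AntitoneOn A (Icc 0 1)
  mapsA : MapsTo A (Icc 0 1) (Icc 0 1)
  mapsB : MapsTo B (Icc 0 1) (Icc 0 1)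
  mapsC : MapsTo C (Icc 0 1) (Icc 0 1)
  contB : ContinuousOn B (Icc 0 1)
  contC : ContinuousOn C (Icc 0 1)
  B0 : B 0 = 0
  C0 : C 0 = 1
  C1 : C 1 = 0
  derivB : ∀ x ∈ Ioo (0 : ℝ) 1, HasDerivAt B (B' x) x
  derivC : ∀ x ∈ Ioo (0 : ℝ) 1, HasDerivAt C (-(A x * B' x) / k) x
  nonneg : ∀ x ∈ Ioo (0 : ℝ) 1, 0 ≤ B' x

namespace StepData

variable {A B C B' : ℝ → ℝ} {k : ℝ}

theorem le_left (H : StepData A B C B' k) {u : ℝ} (hu : u ∈ Icc (0 : ℝ) 1) :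
    k * (1 - C u) ≤ B u ∧ A u * B u ≤ k * (1 - C u) := by
  have hk := H.pos.ne'
  have hs : Icc 0 u ⊆ Icc (0 : ℝ) 1 := Icc_subset_Icc_right hu.2
  have ho : Ioo 0 u ⊆ Ioo (0 : ℝ) 1 := Ioo_subset_Ioo_right hu.2
  have cB := H.contB.mono hs
  have cC := H.contC.mono hs
  constructor
  · have := le_of_hasDerivAt_nonneg (f := fun x => k * C x + B x)
      (f' := fun x => k * (-(A x * B' x) / k) + B' x) ((cC.const_mul k).add cB)
      (fun x hx => ((H.derivC x (ho hx)).const_mul k).add (H.derivB x (ho hx)))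
      (fun x hx => by
        have h1 := (H.mapsA (Ioo_subset_Icc_self (ho hx))).2
        have h2 := H.nonneg x (ho hx)
        have : k * (-(A x * B' x) / k) = -(A x * B' x) := by field_simp
        rw [this]; nlinarith) le_rfl hu.1 le_rfl
    simp only [H.C0, H.B0] at this
    linarith
  · have := le_of_hasDerivAt_nonneg (f := fun x => -(k * C x + A u * B x))
      (f' := fun x => -(k * (-(A x * B' x) / k) + A u * B' x))
      ((cC.const_mul k).add (cB.const_mul _)).neg
      (fun x hx => (((H.derivC x (ho hx)).const_mul k).add ((H.derivB x (ho hx)).const_mul _)).neg)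
      (fun x hx => by
        have h1 := H.anti (Ioo_subset_Icc_self (ho hx)) hu hx.2.le
        have h2 := H.nonneg x (ho hx)
        have : k * (-(A x * B' x) / k) = -(A x * B' x) := by field_simp
        rw [this]; nlinarith) le_rfl hu.1 le_rfl
    simp only [H.C0, H.B0] at this
    linarith

theorem le_right (H : StepData A B C B' k) {v : ℝ} (hv : v ∈ Icc (0 : ℝ) 1) :
    k * C v ≤ A v * (1 - B v) := by
  have hk := H.pos.ne'
  have hs : Icc v 1 ⊆ Icc (0 : ℝ) 1 := Icc_subset_Icc_left hv.1
  have ho : Ioo v 1 ⊆ Ioo (0 : ℝ) 1 := Ioo_subset_Ioo_left hv.1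
  have := le_of_hasDerivAt_nonneg (f := fun x => k * C x + A v * B x)
      (f' := fun x => k * (-(A x * B' x) / k) + A v * B' x)
      (((H.contC.mono hs).const_mul k).add ((H.contB.mono hs).const_mul _))
      (fun x hx => ((H.derivC x (ho hx)).const_mul k).add ((H.derivB x (ho hx)).const_mul _))
      (fun x hx => by
        have h1 := H.anti hv (Ioo_subset_Icc_self (ho hx)) hx.1.le
        have h2 := H.nonneg x (ho hx)
        have : k * (-(A x * B' x) / k) = -(A x * B' x) := by field_simp
        rw [this]; nlinarith) le_rfl hv.2 le_rfl
  simp only [H.C1] at this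
  nlinarith [(H.mapsA hv).1, (H.mapsB (right_mem_Icc.2 zero_le_one)).2]

end StepData

/-- Approximations `PA`, `PB`, `PC` of `A`, `B`, `C` on a window `[u, v]`, almost satisfying
`K PC' = -PA PB'`. -/
structure StepApprox (A B PA PB PC PA' PB' PC' : ℝ → ℝ) (K u v eA eB ηA ηB ηC r : ℝ) : Prop where
  u0 : 0 ≤ u
  uv : u ≤ v
  v1 : v ≤ 1
  K0 : 1 / 4 ≤ K
  ηA0 : 0 ≤ ηA
  ηB0 : 0 ≤ ηB
  derivPA : ∀ x, HasDerivAt PA (PA' x) x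
  derivPB : ∀ x, HasDerivAt PB (PB' x) x
  derivPC : ∀ x, HasDerivAt PC (PC' x) x
  errA : ∀ x ∈ Icc u v, |A x - PA x| ≤ eA
  errB : ∀ x ∈ Icc u v, |B x - PB x| ≤ eB
  PA0 : ∀ x ∈ Icc u v, 0 ≤ PA x
  PA2 : ∀ x ∈ Icc u v, PA x ≤ 2
  derivPA_le : ∀ x ∈ Icc u v, PA' x ≤ ηA
  le_derivPB : ∀ x ∈ Icc u v, -ηB ≤ PB' x
  res : ∀ x ∈ Icc u v, |K * PC' x + PA x * PB' x| ≤ r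
  hηC : 8 * ηB + 4 * r ≤ ηC
  PCv : ηC ≤ PC v
  PCu : PC u + ηC ≤ 2

namespace StepApprox

variable {A B C B' PA PB PC PA' PB' PC' : ℝ → ℝ} {k K u v eA eB ηA ηB ηC r : ℝ}

theorem deriv_le (P : StepApprox A B PA PB PC PA' PB' PC' K u v eA eB ηA ηB ηC r)
    {x : ℝ} (hx : x ∈ Icc u v) : PC' x ≤ ηC := by
  have h1 := (abs_le.1 (P.res x hx)).2
  have h2 : -(2 * ηB) ≤ PA x * PB' x := by
    nlinarith [P.PA0 x hx, P.PA2 x hx, P.le_derivPB x hx, P.ηB0]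
  have h3 := P.hηC
  have h4 := P.K0
  have h6 := P.ηB0
  have h5 : 0 ≤ r := (abs_nonneg _).trans (P.res x hx)
  by_contra! h
  have : 1 / 4 * ηC < K * PC' x := by nlinarith
  linarith

theorem PC_mem (P : StepApprox A B PA PB PC PA' PB' PC' K u v eA eB ηA ηB ηC r)
    {x : ℝ} (hx : x ∈ Icc u v) : 0 ≤ PC x ∧ PC x ≤ 2 := by
  have hm : ∀ {x y}, u ≤ x → x ≤ y → y ≤ v → PC y - PC x ≤ ηC * (y - x) := fun {x y} h1 h2 h3 => by
    have := le_of_hasDerivAt_nonneg (f := fun x => ηC * x - PC x) (f' := fun x => ηC * 1 - PC' x)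
      (a := u) (b := v)
      (fun x _ => (((hasDerivAt_id x).const_mul ηC).sub (P.derivPC x)).continuousAt.continuousWithinAt)
      (fun x _ => ((hasDerivAt_id x).const_mul ηC).sub (P.derivPC x))
      (fun x hx => by have := P.deriv_le (Ioo_subset_Icc_self hx); linarith) h1 h2 h3
    linarith
  have h1 := hm hx.1 hx.2 le_rfl
  have h2 := hm le_rfl hx.1 hx.2
  have h3 := P.PCv
  have h4 := P.PCu
  have h5 : 0 ≤ r := (abs_nonneg _).trans (P.res x hx)
  have h6 : 0 ≤ ηC := by have := P.hηC; have := P.ηB0; linarith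
  have h7 : v - x ≤ 1 := by have := P.u0; have := P.v1; linarith [hx.1]
  have h8 : x - u ≤ 1 := by have := P.u0; have := P.v1; linarith [hx.2]
  constructor <;> nlinarith

theorem bound (P : StepApprox A B PA PB PC PA' PB' PC' K u v eA eB ηA ηB ηC r)
    (H : StepData A B C B' k) {G : ℝ}
    (hG : eA + eB + 2 * eB * (|1 - PA u| + |PA v| + ηA) + (|1 - PA u| + eA) * (|PB u| + eB) +
      (|1 - PB v| + eB) * (|PA v| + eA) + |K * (1 - PC u) - PB u| + |K * PC v| + r ≤ G) :
    |k - K| ≤ G ∧ ∀ x ∈ Icc u v, k * |C x - PC x| ≤ 2 * G := by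
  have hk := H.pos.ne'
  have huv := P.uv
  have hs : Icc u v ⊆ Icc (0 : ℝ) 1 := Icc_subset_Icc P.u0 P.v1
  have ho : Ioo u v ⊆ Ioo (0 : ℝ) 1 := Ioo_subset_Ioo P.u0 P.v1
  have hu : u ∈ Icc u v := left_mem_Icc.2 huv
  have hv : v ∈ Icc u v := right_mem_Icc.2 huv
  have eA0 : 0 ≤ eA := (abs_nonneg _).trans (P.errA u hu)
  have eB0 : 0 ≤ eB := (abs_nonneg _).trans (P.errB u hu)
  have r0 : 0 ≤ r := (abs_nonneg _).trans (P.res u hu)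
  have hη := P.ηA0
  have cB := H.contB.mono hs
  have cC := H.contC.mono hs
  have cPA : ContinuousOn PA (Icc u v) := fun x _ => (P.derivPA x).continuousAt.continuousWithinAt
  have cPB : ContinuousOn PB (Icc u v) := fun x _ => (P.derivPB x).continuousAt.continuousWithinAt
  have cPC : ContinuousOn PC (Icc u v) := fun x _ => (P.derivPC x).continuousAt.continuousWithinAt
  let Φ : ℝ → ℝ := fun x => k * C x - K * PC x + PA x * (B x - PB x)
  let Φ' : ℝ → ℝ := fun x => k * (-(A x * B' x) / k) - K * PC' x +
    (PA' x * (B x - PB x) + PA x * (B' x - PB' x))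
  let g : ℝ → ℝ := fun x => eA * B x - eB * PA x + (2 * ηA * eB + r) * x
  let g' : ℝ → ℝ := fun x => eA * B' x - eB * PA' x + (2 * ηA * eB + r) * 1
  have cΦ : ContinuousOn Φ (Icc u v) :=
    ((cC.const_mul k).sub (cPC.const_mul K)).add (cPA.mul (cB.sub cPB))
  have cg : ContinuousOn g (Icc u v) :=
    ((cB.const_mul _).sub (cPA.const_mul _)).add (continuousOn_id.const_mul _)
  have dΦ : ∀ x ∈ Ioo u v, HasDerivAt Φ (Φ' x) x := fun x hx =>
    (((H.derivC x (ho hx)).const_mul k).sub ((P.derivPC x).const_mul K)).add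
      ((P.derivPA x).mul ((H.derivB x (ho hx)).sub (P.derivPB x)))
  have dg : ∀ x ∈ Ioo u v, HasDerivAt g (g' x) x := fun x hx =>
    (((H.derivB x (ho hx)).const_mul _).sub ((P.derivPA x).const_mul _)).add
      ((hasDerivAt_id x).const_mul _)
  have key : ∀ x ∈ Ioo u v, |Φ' x| ≤ g' x := fun x hx => by
    have hx' := Ioo_subset_Icc_self hx
    have e : Φ' x = -((A x - PA x) * B' x) + PA' x * (B x - PB x) -
        (K * PC' x + PA x * PB' x) := by
      simp only [Φ']; field_simp; ring
    have h1 : |(A x - PA x) * B' x| ≤ eA * B' x := by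
      rw [abs_mul, abs_of_nonneg (H.nonneg x (ho hx))]
      exact mul_le_mul_of_nonneg_right (P.errA x hx') (H.nonneg x (ho hx))
    have h2 : |PA' x * (B x - PB x)| ≤ (-PA' x + 2 * ηA) * eB := by
      rw [abs_mul]
      refine mul_le_mul ?_ (P.errB x hx') (abs_nonneg _) ?_
      · rw [abs_le]; constructor <;> linarith [P.derivPA_le x hx']
      · linarith [P.derivPA_le x hx']
    have h3 := P.res x hx'
    rw [abs_le] at h1 h2 h3 ⊢
    rw [e]
    simp only [g']
    constructor <;> nlinarith
  have hV : ∀ {x y}, u ≤ x → x ≤ y → y ≤ v → |Φ y - Φ x| ≤ g y - g x := fun {x y} h1 h2 h3 => by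
    have i1 := le_of_hasDerivAt_nonneg (cg.sub cΦ) (fun x hx => (dg x hx).sub (dΦ x hx))
      (fun x hx => by have := (abs_le.1 (key x hx)).2; linarith) h1 h2 h3
    have i2 := le_of_hasDerivAt_nonneg (cg.add cΦ) (fun x hx => (dg x hx).add (dΦ x hx))
      (fun x hx => by have := (abs_le.1 (key x hx)).1; linarith) h1 h2 h3
    simp only [Pi.sub_apply, Pi.add_apply] at i1 i2
    rw [abs_le]; constructor <;> linarith
  obtain ⟨tu1, tu2⟩ := H.le_left (hs hu)
  have tv := H.le_right (hs hv)
  have Au := H.mapsA (hs hu)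
  have Av := H.mapsA (hs hv)
  have Bu := H.mapsB (hs hu)
  have Bv := H.mapsB (hs hv)
  have Cv := mul_nonneg H.pos.le (H.mapsC (hs hv)).1
  have eAu := P.errA u hu
  have eAv := P.errA v hv
  have eBu := P.errB u hu
  have eBv := P.errB v hv
  have t1 : (1 - A u) * B u ≤ (|1 - PA u| + eA) * (|PB u| + eB) := by
    refine mul_le_mul ?_ ?_ Bu.1 (by positivity)
    · linarith [le_abs_self (1 - PA u), (abs_le.1 eAu).1]
    · linarith [le_abs_self (PB u), (abs_le.1 eBu).2]
  have t2 : A v * (1 - B v) ≤ (|1 - PB v| + eB) * (|PA v| + eA) := by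
    rw [mul_comm]
    refine mul_le_mul ?_ ?_ Av.1 (by positivity)
    · linarith [le_abs_self (1 - PB v), (abs_le.1 eBv).1]
    · linarith [le_abs_self (PA v), (abs_le.1 eAv).2]
  have s1 : |(B u - PB u) * (1 - PA u)| ≤ eB * |1 - PA u| := by
    rw [abs_mul]; exact mul_le_mul_of_nonneg_right eBu (abs_nonneg _)
  have s2 : |PA v * (B v - PB v)| ≤ eB * |PA v| := by
    rw [abs_mul, mul_comm]; exact mul_le_mul_of_nonneg_right eBv (abs_nonneg _)
  have V1 := hV le_rfl huv le_rfl
  have Φu : Φ u = (k - K) + (K * (1 - PC u) - PB u) - (B u - PB u) * (1 - PA u) +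
      (B u - k * (1 - C u)) := by simp only [Φ]; ring
  have Φv : Φ v = k * C v - K * PC v + PA v * (B v - PB v) := rfl
  have gb : ∀ {y}, u ≤ y → y ≤ v →
      g y - g u ≤ eA + eB * (PA u - PA y) + 2 * ηA * eB + r := fun {y} h1 h2 => by
    have b1 := H.mapsB (hs ⟨h1, h2⟩)
    have : g y - g u = eA * (B y - B u) + eB * (PA u - PA y) + (2 * ηA * eB + r) * (y - u) := by
      simp only [g]; ring
    rw [this]
    have j1 : eA * (B y - B u) ≤ eA * 1 := mul_le_mul_of_nonneg_left (by linarith [b1.2, Bu.1]) eA0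
    have j2 : (2 * ηA * eB + r) * (y - u) ≤ (2 * ηA * eB + r) * 1 :=
      mul_le_mul_of_nonneg_left (by linarith [P.u0, P.v1]) (by positivity)
    linarith
  have pu : eB * PA u ≤ eB * (1 + |1 - PA u|) :=
    mul_le_mul_of_nonneg_left (by linarith [neg_abs_le (1 - PA u)]) eB0
  have pv : 0 ≤ eB * |PA v| := by positivity
  have pd : 0 ≤ eB * |1 - PA u| := by positivity
  have pη : 0 ≤ ηA * eB := by positivity
  have pPA : 0 ≤ eB * PA v := mul_nonneg eB0 (P.PA0 v hv)
  have q1 : 0 ≤ (|1 - PA u| + eA) * (|PB u| + eB) := by positivity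
  have q2 : 0 ≤ (|1 - PB v| + eB) * (|PA v| + eA) := by positivity
  have q3 := abs_nonneg (K * (1 - PC u) - PB u)
  have q4 := abs_nonneg (K * PC v)
  have n3 := abs_le.1 (le_refl |K * (1 - PC u) - PB u|)
  have n4 := abs_le.1 (le_refl |K * PC v|)
  have V2 := abs_le.1 (V1.trans (gb huv le_rfl))
  rw [Φu, Φv] at V2
  rw [abs_le] at s1 s2
  have hG' : eA + eB + (2 * (eB * |1 - PA u|) + 2 * (eB * |PA v|) + 2 * (ηA * eB)) +
      (|1 - PA u| + eA) * (|PB u| + eB) + (|1 - PB v| + eB) * (|PA v| + eA) +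
      |K * (1 - PC u) - PB u| + |K * PC v| + r ≤ G := by linarith
  rw [mul_sub eB, mul_assoc 2 ηA eB] at V2
  rw [mul_add eB, mul_one] at pu
  have tu2' : B u - k * (1 - C u) ≤ (1 - A u) * B u := by linarith
  have tu1' : 0 ≤ B u - k * (1 - C u) := by linarith
  have main : |k - K| ≤ G := by
    generalize (1 - A u) * B u = z1 at *
    generalize A v * (1 - B v) = z2 at *
    generalize (|1 - PA u| + eA) * (|PB u| + eB) = z3 at *
    generalize (|1 - PB v| + eB) * (|PA v| + eA) = z4 at *
    generalize K * (1 - PC u) - PB u = z5 at *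
    generalize K * PC v = z6 at *
    generalize B u - k * (1 - C u) = z7 at *
    generalize (B u - PB u) * (1 - PA u) = z8 at *
    generalize PA v * (B v - PB v) = z9 at *
    generalize k * C v = z10 at *
    rw [abs_le]
    clear hV dg dΦ cg cΦ key H P
    constructor <;> linarith
  refine ⟨main, fun x hx => ?_⟩
  have W := abs_le.1 ((hV le_rfl hx.1 hx.2).trans (gb hx.1 hx.2))
  have s3 : |PA x * (B x - PB x)| ≤ eB * PA x := by
    rw [abs_mul, mul_comm, abs_of_nonneg (P.PA0 x hx)]
    exact mul_le_mul_of_nonneg_right (P.errB x hx) (P.PA0 x hx)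
  have s4 : |(k - K) * (1 - PC x)| ≤ G := by
    rw [abs_mul]
    have : |1 - PC x| ≤ 1 := by
      have := P.PC_mem hx
      rw [abs_le]; constructor <;> linarith
    exact (mul_le_mul main this (abs_nonneg _) ((abs_nonneg _).trans main)).trans_eq (mul_one G)
  have e : k * (C x - PC x) = (k - K) * (1 - PC x) + (Φ x - Φ u) +
      (K * (1 - PC u) - PB u) - (B u - PB u) * (1 - PA u) +
      (B u - k * (1 - C u)) - PA x * (B x - PB x) := by
    rw [Φu]; simp only [Φ]; ring
  have e' : k * |C x - PC x| = |k * (C x - PC x)| := by rw [abs_mul, abs_of_pos H.pos]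
  rw [e', e, abs_le]
  clear e e'
  rw [abs_le] at s3 s4
  rw [mul_sub eB, mul_assoc 2 ηA eB] at W
  generalize (1 - A u) * B u = z1 at *
  generalize (|1 - PA u| + eA) * (|PB u| + eB) = z3 at *
  generalize (|1 - PB v| + eB) * (|PA v| + eA) = z4 at *
  generalize K * (1 - PC u) - PB u = z5 at *
  generalize B u - k * (1 - C u) = z7 at *
  generalize (B u - PB u) * (1 - PA u) = z8 at *
  generalize PA x * (B x - PB x) = z9 at *
  generalize (k - K) * (1 - PC x) = z10 at *
  generalize Φ x - Φ u = z11 at *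
  clear hV dg dΦ cg cΦ key H P
  constructor <;> linarith

end StepApprox

namespace CoeffTree

theorem force_eq {α : Type} (x : ℕ) (f : ℕ → α) : force x f = f x := by cases x <;> rfl

theorem forceZ_eq {α : Type} (x : ℤ) (f : ℤ → α) : forceZ x f = f x := by
  cases x with
  | ofNat n => exact force_eq n fun n => f (Int.ofNat n)
  | negSucc n => exact force_eq n fun n => f (Int.negSucc n)

theorem shl_eq (x : ℤ) (n : ℕ) : shl x n = x * 2 ^ n := by
  cases x with
  | ofNat a =>
    have : shl (Int.ofNat a) n = ((a <<< n : ℕ) : ℤ) := rfl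
    rw [this, Nat.shiftLeft_eq]; push_cast; rfl
  | negSucc a =>
    have : shl (Int.negSucc a) n = Int.negSucc (((a + 1) <<< n) - 1) := rfl
    rw [this, Nat.shiftLeft_eq, Int.negSucc_eq, Int.negSucc_eq]
    have h1 : 1 ≤ (a + 1) * 2 ^ n := Nat.one_le_iff_ne_zero.2 (by positivity)
    push_cast [h1]; ring

theorem shr_eq (x : ℤ) (n : ℕ) : shr x n = x / 2 ^ n := by
  have := Int.shiftRight_eq_div_pow x n
  push_cast at this
  rw [← this]
  cases x <;> rfl

theorem mpow_eq (m : ℤ) (k : ℕ) : mpow m k = m ^ k := by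
  cases m with
  | ofNat a =>
    have : mpow (Int.ofNat a) k = ((a ^ k : ℕ) : ℤ) := rfl
    rw [this]; push_cast; rfl
  | negSucc a =>
    have : mpow (Int.negSucc a) k = if k % 2 = 0 then (((a + 1) ^ k : ℕ) : ℤ) else
        -(((a + 1) ^ k : ℕ) : ℤ) := by
      have : mpow (Int.negSucc a) k = Bool.rec (motive := fun _ => ℤ) (-(((a + 1) ^ k : ℕ) : ℤ))
        (((a + 1) ^ k : ℕ) : ℤ) (Nat.beq (k % 2) 0) := rfl
      rw [this]
      rcases Nat.mod_two_eq_zero_or_one k with h | h <;> rw [h] <;> rfl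
    rw [this, Int.negSucc_eq]
    split_ifs with h
    · rw [Even.neg_pow (Nat.even_iff.2 h)]; push_cast; rfl
    · rw [Odd.neg_pow (Nat.odd_iff.2 (by lia))]; push_cast; rfl

/-- The polynomial represented by a tree. -/
def toPoly : CoeffTree → ℤ[X]
  | leaf c => C c
  | node k l r => toPoly l + X ^ k * toPoly r

/-- The polynomial `∑ (i + j) c_j X ^ j`, where `c_j` are the coefficients of `t.toPoly`. -/
def derivPoly : CoeffTree → ℕ → ℤ[X]
  | leaf c, i => C (i * c)
  | node k l r, i => derivPoly l i + X ^ k * derivPoly r (i + k)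

theorem pack_eq (W : ℕ) (t : CoeffTree) : pack W t = (toPoly t).eval (2 ^ W) := by
  induction t with
  | leaf c => simp [toPoly, pack]
  | node k l r hl hr =>
    have : pack W (node k l r) = pack W l + shl (pack W r) (W * k) := rfl
    rw [this, shl_eq, hl, hr]
    simp [toPoly, pow_mul, mul_comm]

theorem derivPack_eq (W : ℕ) (t : CoeffTree) (i : ℕ) : derivPack W t i = (derivPoly t i).eval (2 ^ W) := by
  induction t generalizing i with
  | leaf c =>
    have : derivPack W (leaf c) i = i * c := rfl
    simp [derivPoly, this]
  | node k l r hl hr =>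
    have : derivPack W (node k l r) i = derivPack W l i + shl (derivPack W r (i + k)) (W * k) := rfl
    rw [this, shl_eq, hl, hr]
    simp [derivPoly, pow_mul, mul_comm]

theorem derivative_toPoly (t : CoeffTree) (i : ℕ) :
    derivative (X ^ (i + 1) * toPoly t) = X ^ i * derivPoly t (i + 1) := by
  induction t generalizing i with
  | leaf c =>
    simp [toPoly, derivPoly]; ring
  | node k l r hl hr =>
    have h2 := hr (i + k)
    have : X ^ (i + 1) * toPoly (node k l r) =
      X ^ (i + 1) * toPoly l + X ^ (i + k + 1) * toPoly r := by simp only [toPoly]; ring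
    rw [this, derivative_add, hl, h2]
    simp only [derivPoly]
    rw [show i + k + 1 = i + 1 + k by ring]; ring

theorem coeff_X_pow_mul_le {p : ℤ[X]} {M : ℤ} (hM : ∀ j, |p.coeff j| ≤ M) (k j : ℕ) :
    |(X ^ k * p).coeff j| ≤ M := by
  rw [coeff_X_pow_mul']
  split_ifs
  · exact hM _
  · simpa using (abs_nonneg _).trans (hM 0)

theorem coeff_toPoly_mul_le {p : ℤ[X]} {M : ℤ} (hM : ∀ j, |p.coeff j| ≤ M) (t : CoeffTree) (j : ℕ) :
    |(toPoly t * p).coeff j| ≤ l1 t * M := by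
  induction t generalizing j with
  | leaf c =>
    have : (l1 (leaf c) : ℤ) = |c| := Int.natCast_natAbs c
    rw [this, toPoly, coeff_C_mul, abs_mul]
    exact mul_le_mul_of_nonneg_left (hM j) (abs_nonneg _)
  | node k l r hl hr =>
    have : l1 (node k l r) = l1 l + l1 r := rfl
    rw [this, toPoly, add_mul, coeff_add, mul_assoc]
    refine (abs_add_le _ _).trans ?_
    push_cast
    rw [add_mul]
    exact add_le_add (hl j) (coeff_X_pow_mul_le hr k j)

theorem coeff_derivPoly_le (t : CoeffTree) (i j : ℕ) : |(derivPoly t i).coeff j| ≤ derivL1 t i := by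
  induction t generalizing i j with
  | leaf c =>
    have : derivL1 (leaf c) i = i * c.natAbs := rfl
    rw [this, derivPoly, coeff_C]
    split_ifs
    · simp [abs_mul]
    · simp; positivity
  | node k l r hl hr =>
    have : derivL1 (node k l r) i = derivL1 l i + derivL1 r (i + k) := rfl
    rw [this, derivPoly, coeff_add]
    refine (abs_add_le _ _).trans ?_
    push_cast
    exact add_le_add (hl i j) (coeff_X_pow_mul_le (hr (i + k)) k j)

/-- The number of leaves. -/
def cnt : CoeffTree → ℕ
  | leaf _ => 1
  | node _ l r => cnt l + cnt r

theorem abs_aeval_sub_ev_le {m : ℤ} (hm : |m| ≤ 4096) (t : CoeffTree) :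
    |aeval ((m : ℝ) / 4096) (toPoly t) - ev m t| ≤ (cnt t : ℝ) - 1 := by
  have hs : |(m : ℝ) / 4096| ≤ 1 := by
    rw [abs_div, abs_of_pos (by norm_num : (0 : ℝ) < 4096), div_le_one (by norm_num)]
    exact_mod_cast hm
  induction t with
  | leaf c => simp [toPoly, ev, cnt]
  | node k l r hl hr =>
    have e : ev m (node k l r) = ev m l + shr (ev m r * mpow m k) (12 * k) := rfl
    rw [e, shr_eq, mpow_eq, cnt, toPoly]
    have h1 : |(((m : ℝ) / 4096) ^ k) * (aeval ((m : ℝ) / 4096) (toPoly r) - ev m r)| ≤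
        (cnt r : ℝ) - 1 := by
      rw [abs_mul, abs_pow]
      exact (mul_le_of_le_one_left (abs_nonneg _) (pow_le_one₀ (abs_nonneg _) hs)).trans hr
    have h2 : ((ev m r * m ^ k / 2 ^ (12 * k) : ℤ) : ℝ) ≤ (m / 4096 : ℝ) ^ k * ev m r ∧
        (m / 4096 : ℝ) ^ k * ev m r ≤ ((ev m r * m ^ k / 2 ^ (12 * k) : ℤ) : ℝ) + 1 := by
      have hp : (0 : ℝ) < 4096 ^ k := by positivity
      have hz : (0 : ℤ) < 2 ^ (12 * k) := by positivity
      have h3 : (2 : ℝ) ^ (12 * k) = 4096 ^ k := by rw [pow_mul]; norm_num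
      have h4 := Int.ediv_mul_le (ev m r * m ^ k) hz.ne'
      have h5 := (Int.lt_ediv_add_one_mul_self (ev m r * m ^ k) hz).le
      have h4' : ((ev m r * m ^ k / 2 ^ (12 * k) : ℤ) : ℝ) * 2 ^ (12 * k) ≤ ev m r * m ^ k := by
        exact_mod_cast h4
      have h5' : (ev m r * m ^ k : ℝ) ≤
        (((ev m r * m ^ k / 2 ^ (12 * k) : ℤ) : ℝ) + 1) * 2 ^ (12 * k) := by exact_mod_cast h5
      rw [h3] at h4' h5'
      have h6 : (m / 4096 : ℝ) ^ k * ev m r = ev m r * m ^ k / 4096 ^ k := by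
        rw [div_pow]; ring
      rw [h6, le_div_iff₀ hp, div_le_iff₀ hp]
      exact ⟨h4', h5'⟩
    rw [abs_le] at hl h1 ⊢
    simp only [map_add, map_mul, map_pow, aeval_X]
    push_cast at h2 ⊢
    constructor <;> linarith [h2.1, h2.2]

theorem abs_aeval_sub_eval_le {m : ℤ} (hm : |m| ≤ 4096) (a : ℤ) (t : CoeffTree) :
    |(a + (m : ℝ) / 4096 * aeval ((m : ℝ) / 4096) (toPoly t)) - eval m a t| ≤ (cnt t : ℝ) := by
  have hs : |(m : ℝ) / 4096| ≤ 1 := by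
    rw [abs_div, abs_of_pos (by norm_num : (0 : ℝ) < 4096), div_le_one (by norm_num)]
    exact_mod_cast hm
  have e : eval m a t = a + shr (ev m t * m) 12 := rfl
  rw [e, shr_eq]
  have h1 : |((m : ℝ) / 4096) * (aeval ((m : ℝ) / 4096) (toPoly t) - ev m t)| ≤
      (cnt t : ℝ) - 1 := by
    rw [abs_mul]
    exact (mul_le_of_le_one_left (abs_nonneg _) hs).trans (abs_aeval_sub_ev_le hm t)
  have h4 := Int.ediv_mul_le (ev m t * m) (by norm_num : (2 ^ 12 : ℤ) ≠ 0)
  have h5 := (Int.lt_ediv_add_one_mul_self (ev m t * m) (by norm_num : (0 : ℤ) < 2 ^ 12)).le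
  have h4' : ((ev m t * m / 2 ^ 12 : ℤ) : ℝ) * 2 ^ 12 ≤ ev m t * m := by exact_mod_cast h4
  have h5' : (ev m t * m : ℝ) ≤ (((ev m t * m / 2 ^ 12 : ℤ) : ℝ) + 1) * 2 ^ 12 := by
    exact_mod_cast h5
  rw [abs_le] at h1 ⊢
  push_cast at h4' h5' ⊢
  norm_num at h4' h5'
  constructor <;> linarith

/-- The tree computed by `mk`. -/
def mkT (W H K : ℕ) : ℕ → ℕ → ℕ → CoeffTree
  | 0, i, v => leaf (qt H K i v)
  | d + 1, i, v => node (2 ^ d) (mkT W H K d i (v % 2 ^ (W * 2 ^ d)))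
      (mkT W H K d (i + 2 ^ d) (v / 2 ^ (W * 2 ^ d)))

/-- The polynomial with `2 ^ d` coefficients packed in `v`, each of them shifted by `H`. -/
def unpack (W H : ℕ) : ℕ → ℕ → ℤ[X]
  | 0, v => C ((v : ℤ) - H)
  | d + 1, v => unpack W H d (v % 2 ^ (W * 2 ^ d)) +
      X ^ 2 ^ d * unpack W H d (v / 2 ^ (W * 2 ^ d))

theorem sub_shiftLeft_shiftRight (v n : ℕ) : v - (v >>> n) <<< n = v % 2 ^ n := by
  rw [Nat.shiftRight_eq_div_pow, Nat.shiftLeft_eq]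
  have := Nat.div_add_mod' v (2 ^ n)
  lia

theorem mk_eq {α : Type} (W H K d i v : ℕ) (f : CoeffTree → α) :
    mk W H K d i v f = f (mkT W H K d i v) := by
  induction d generalizing i v f with
  | zero => exact forceZ_eq (qt H K i v) fun c => f (leaf c)
  | succ d ih =>
    have : mk W H K (d + 1) i v f = force (2 ^ d) fun e => force (W * e) fun n =>
      force (v >>> n) fun h => force (v - h <<< n) fun l =>
      mk W H K d i l fun t => mk W H K d (i + e) h fun s => f (node e t s) := rfl
    rw [this]
    simp only [force_eq, ih, sub_shiftLeft_shiftRight, mkT]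
    rw [Nat.shiftRight_eq_div_pow]

theorem cnt_mkT (W H K d i v : ℕ) : cnt (mkT W H K d i v) = 2 ^ d := by
  induction d generalizing i v with
  | zero => rfl
  | succ d ih => rw [mkT, cnt, ih, ih]; ring

theorem offset_zero (W : ℕ) : offset W 0 = 2 ^ (W - 1) := rfl

theorem offset_succ (W d : ℕ) : offset W (d + 1) = offset W d + offset W d * 2 ^ (W * 2 ^ d) := by
  have : offset W (d + 1) = offset W d + offset W d <<< (W * 2 ^ d) := rfl
  rw [this, Nat.shiftLeft_eq]

theorem eval_unpack (W d v : ℕ) :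
    (unpack W (2 ^ (W - 1)) d v).eval (2 ^ W) + offset W d = v := by
  induction d generalizing v with
  | zero => simp [unpack, offset_zero]
  | succ d ih =>
    have h1 := ih (v % 2 ^ (W * 2 ^ d))
    have h2 := ih (v / 2 ^ (W * 2 ^ d))
    have h3 : (v : ℤ) = ((v / 2 ^ (W * 2 ^ d) : ℕ) : ℤ) * 2 ^ (W * 2 ^ d) +
        ((v % 2 ^ (W * 2 ^ d) : ℕ) : ℤ) := by exact_mod_cast (Nat.div_add_mod' v _).symm
    rw [h3, ← h1, ← h2, offset_succ]
    simp only [unpack, eval_add, eval_mul, eval_pow, eval_X, ← pow_mul]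
    push_cast
    ring

theorem natDegree_unpack_lt (W H d v : ℕ) (j : ℕ) (hj : 2 ^ d ≤ j) : (unpack W H d v).coeff j = 0 := by
  induction d generalizing v j with
  | zero => rw [unpack, coeff_C, if_neg]; lia
  | succ d ih =>
    rw [pow_succ] at hj
    rw [unpack, coeff_add, ih _ _ (by lia), coeff_X_pow_mul']
    split_ifs
    · rw [ih _ _ (by lia), add_zero]
    · rfl

theorem coeff_unpack_le {W d v : ℕ} (hW : 1 ≤ W) (hv : v < 2 ^ (W * 2 ^ d)) (j : ℕ) :
    |(unpack W (2 ^ (W - 1)) d v).coeff j| ≤ 2 ^ (W - 1) := by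
  induction d generalizing v j with
  | zero =>
    have h2 : (2 : ℕ) ^ W = 2 * 2 ^ (W - 1) := by
      rw [← pow_succ', Nat.sub_add_cancel hW]
    rw [pow_zero, mul_one, h2] at hv
    rw [unpack, coeff_C]
    split_ifs
    · rw [abs_le]; push_cast; zify at hv; constructor <;> linarith
    · simp
  | succ d ih =>
    have h1 : v / 2 ^ (W * 2 ^ d) < 2 ^ (W * 2 ^ d) := by
      rw [Nat.div_lt_iff_lt_mul (by positivity), ← pow_add]
      convert hv using 2; ring
    have h2 : v % 2 ^ (W * 2 ^ d) < 2 ^ (W * 2 ^ d) := Nat.mod_lt _ (by positivity)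
    rw [unpack, coeff_add, coeff_X_pow_mul']
    split_ifs with hj
    · rw [natDegree_unpack_lt _ _ _ _ _ hj, zero_add]; exact ih h1 _
    · rw [add_zero]; exact ih h2 _

/-- Integer polynomials with small coefficients are determined by one value. -/
theorem eq_of_eval_eq {p q : ℤ[X]} {N : ℤ} (hN : 0 < N)
    (hc : ∀ j, |p.coeff j - q.coeff j| < N) (he : p.eval N = q.eval N) : p = q := by
  suffices H : ∀ (n : ℕ) (r : ℤ[X]), r.natDegree < n → (∀ j, |r.coeff j| < N) → r.eval N = 0 → r = 0 from
    sub_eq_zero.1 (H _ (p - q) (Nat.lt_succ_self _) (fun j => by rw [coeff_sub]; exact hc j)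
      (by rw [eval_sub, he, sub_self]))
  intro n
  induction n with
  | zero => intro r hr; exact absurd hr (Nat.not_lt_zero _)
  | succ n ih =>
    intro r hr hc he
    have h1 := divX_mul_X_add r
    have h2 : r.divX.eval N * N + r.coeff 0 = 0 := by
      rw [← he]; conv_rhs => rw [← h1]
      simp
    have h3 : r.coeff 0 = 0 := Int.eq_zero_of_abs_lt_dvd ⟨-r.divX.eval N, by linarith⟩ (hc 0)
    have h4 : r.divX.eval N = 0 := by
      rw [h3, add_zero] at h2
      exact (mul_eq_zero.1 h2).resolve_right hN.ne'
    have h5 : r.divX = 0 := by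
      rcases Nat.eq_zero_or_pos r.natDegree with h | h
      · rw [divX_eq_zero_iff]; exact eq_C_of_natDegree_eq_zero h
      · refine ih _ ?_ (fun j => by rw [coeff_divX]; exact hc _) h4
        rw [natDegree_divX_eq_natDegree_tsub_one]; lia
    rw [← h1, h5, h3]; simp

theorem abs_residual_le {W H K d i v : ℕ} (hK : 0 < K) (hi : 0 < i) {s : ℝ} (hs : |s| ≤ 1) :
    |K * aeval s (derivPoly (mkT W H K d i v) i) + aeval s (unpack W H d v)| ≤
      K * (2 ^ d * (i + 2 ^ d - 1)) := by
  induction d generalizing i v with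
  | zero =>
    have h1 : |(K : ℤ) * (i * qt H K i v) + (v - H)| ≤ K * i := by
      have e : qt H K i v = if H ≤ v then -((((v - H) / (K * i) : ℕ)) : ℤ) else
          (((H - v) / (K * i) : ℕ) : ℤ) := by
        have : qt H K i v = Bool.rec (motive := fun _ => ℤ) ((((H - v) / (K * i) : ℕ)) : ℤ)
          (-((((v - H) / (K * i) : ℕ)) : ℤ)) (Nat.ble H v) := rfl
        rw [this]
        rcases hb : Nat.ble H v with _ | _
        · rw [if_neg]; rw [← Nat.ble_eq, hb]; simp
        · rw [if_pos (Nat.le_of_ble_eq_true hb)]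
      have hKi : 0 < K * i := Nat.mul_pos hK hi
      rw [e]
      split_ifs with h
      · have h1 := Nat.div_mul_le_self (v - H) (K * i)
        have h2 := (Nat.lt_div_mul_add hKi (a := v - H)).le
        zify [h] at h1 h2 ⊢
        rw [abs_le]; constructor <;> linarith
      · have h' : v ≤ H := by lia
        have h1 := Nat.div_mul_le_self (H - v) (K * i)
        have h2 := (Nat.lt_div_mul_add hKi (a := H - v)).le
        zify [h'] at h1 h2 ⊢
        rw [abs_le]; constructor <;> linarith
    have h1' : |(K : ℝ) * (i * qt H K i v) + (v - H)| ≤ K * i := by exact_mod_cast h1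
    simp only [mkT, derivPoly, unpack, eq_intCast, map_intCast, pow_zero]
    push_cast
    convert h1' using 1
    ring
  | succ d ih =>
    have h1 := ih hi (v := v % 2 ^ (W * 2 ^ d))
    have h2 := ih (i := i + 2 ^ d) (by lia) (v := v / 2 ^ (W * 2 ^ d))
    simp only [mkT, derivPoly, unpack, map_add, map_mul, map_pow, aeval_X]
    have e : ∀ a b c d z : ℝ, K * (a + z * b) + (c + z * d) = (K * a + c) + z * (K * b + d) := by
      intros; ring
    rw [e]
    refine (abs_add_le _ _).trans ?_
    rw [abs_mul, abs_pow]
    have h3 := (mul_le_of_le_one_left (abs_nonneg _)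
      (pow_le_one₀ (n := 2 ^ d) (abs_nonneg s) hs)).trans h2
    refine (add_le_add h1 h3).trans ?_
    have h4 : (0 : ℝ) ≤ K * 2 ^ d * 2 ^ d := by positivity
    push_cast
    rw [pow_succ]
    linarith

theorem hb_succ (W H ρ d v : ℕ) : hb W H ρ (d + 1) v =
    hb W H ρ d (v % 2 ^ (W * 2 ^ d)) +
      hb W H ρ d (v / 2 ^ (W * 2 ^ d)) * ρ ^ 2 ^ d / 2 ^ (12 * 2 ^ d) + 1 := by
  have : hb W H ρ (d + 1) v = force (W * 2 ^ d) fun n => force (v >>> n) fun h =>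
      force (v - h <<< n) fun l => hb W H ρ d l + (hb W H ρ d h * ρ ^ 2 ^ d) >>> (12 * 2 ^ d) + 1 := rfl
  rw [this]
  simp only [force_eq, sub_shiftLeft_shiftRight]
  rw [Nat.shiftRight_eq_div_pow, Nat.shiftRight_eq_div_pow]

/-- Scaling by `(ρ / 4096) ^ e`, rounded up. -/
theorem mul_pow_le_div {ρ n e : ℕ} {x s : ℝ} (hx : |x| ≤ n) (hs : |s| ≤ ρ / 4096) :
    |s ^ e * x| ≤ (n * ρ ^ e / 2 ^ (12 * e) : ℕ) + 1 := by
  have h1 : (n * ρ ^ e : ℝ) / 4096 ^ e ≤ (n * ρ ^ e / 2 ^ (12 * e) : ℕ) + 1 := by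
    rw [div_le_iff₀ (by positivity)]
    have := (Nat.lt_div_mul_add (a := n * ρ ^ e) (b := 2 ^ (12 * e)) (by positivity)).le
    rw [← Nat.succ_mul] at this
    have h3 : (4096 : ℝ) ^ e = 2 ^ (12 * e) := by rw [pow_mul]; norm_num
    rw [h3]
    exact_mod_cast this
  refine le_trans ?_ h1
  rw [abs_mul, abs_pow, mul_comm]
  calc |x| * |s| ^ e ≤ n * (ρ / 4096) ^ e := by gcongr
    _ = _ := by rw [div_pow]; ring

theorem abs_aeval_unpack_le {W H ρ : ℕ} {s : ℝ} (hs : |s| ≤ ρ / 4096) (d v : ℕ) :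
    |aeval s (unpack W H d v)| ≤ hb W H ρ d v := by
  induction d generalizing v with
  | zero =>
    have : hb W H ρ 0 v = (v - H) + (H - v) := rfl
    rw [this, unpack]
    simp only [eq_intCast, map_intCast]
    rcases le_total v H with h | h
    · rw [Nat.sub_eq_zero_of_le h]; push_cast [h]
      have : (v : ℝ) ≤ H := by exact_mod_cast h
      rw [abs_of_nonpos] <;> linarith
    · rw [Nat.sub_eq_zero_of_le h]; push_cast [h]
      have : (H : ℝ) ≤ v := by exact_mod_cast h
      rw [abs_of_nonneg] <;> linarith
  | succ d ih =>
    rw [hb_succ]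
    simp only [unpack, map_add, map_mul, map_pow, aeval_X]
    refine (abs_add_le _ _).trans ?_
    have h1 := ih (v % 2 ^ (W * 2 ^ d))
    have h2 := mul_pow_le_div (e := 2 ^ d) (ih (v / 2 ^ (W * 2 ^ d))) hs
    push_cast at h2 ⊢
    linarith

theorem one_eq : one = 2 ^ 200 := rfl

theorem nonneg_iff (x : ℤ) : nonneg x = true ↔ 0 ≤ x := by
  cases x with
  | ofNat n => exact iff_of_true rfl (Int.natCast_nonneg n)
  | negSucc n => exact iff_of_false Bool.false_ne_true (by have := Int.negSucc_lt_zero n; lia)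

theorem abs_sub_div_le {U x z : ℝ} {d : ℕ} {y : ℤ} (hU : 0 < U) (h : |z * U - x - y| ≤ 512)
    (hd : y.natAbs + 1024 ≤ d) : |z - x / U| ≤ d / U := by
  have e : z - x / U = (z * U - x) / U := by field_simp
  rw [e, abs_div, abs_of_pos hU]
  refine div_le_div_of_nonneg_right ?_ hU.le
  have h1 : |(y : ℝ)| + 1024 ≤ d := by
    rw [← Int.cast_abs, ← Nat.cast_natAbs]; exact_mod_cast hd
  have h2 := abs_add_le (z * U - x - y) y
  rw [sub_add_cancel] at h2
  linarith

theorem one_pos : (0 : ℝ) < one := by rw [one_eq]; positivity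

theorem le_shiftRight (n : ℕ) : (n : ℝ) / one ≤ (n >>> 200 : ℕ) + 1 := by
  rw [Nat.shiftRight_eq_div_pow, div_le_iff₀ one_pos, ← one_eq]
  have := (Nat.lt_div_mul_add (a := n) (b := one) (by rw [one_eq]; positivity)).le
  rw [← Nat.succ_mul] at this
  exact_mod_cast this

theorem error_le {eA eB ηA res K G dA A B dB : ℕ} {Au Av Bu Bv Cu Cv : ℤ}
    {pAu pAv pBu pBv pCu pCv : ℝ}
    (hAu : |pAu - Au| ≤ 512) (hAv : |pAv - Av| ≤ 512) (hBu : |pBu - Bu| ≤ 512)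
    (hBv : |pBv - Bv| ≤ 512) (hCu : |pCu - Cu| ≤ 512) (hCv : |pCv - Cv| ≤ 512)
    (hdA : dA = (one - Au).natAbs + 1024) (hA : A = Av.natAbs + 1024)
    (hB : B = Bu.natAbs + 1024) (hdB : dB = (one - Bv).natAbs + 1024)
    (hK : K ≤ one)
    (h : eA + (eB + (2 * eB * (dA + (A + ηA))) >>> 200) + (((dA + eA) * (B + eB)) >>> 200 +
      (((dB + eB) * (A + eA)) >>> 200 + (K * (one - Cu) - one * Bu).natAbs >>> 200)) +
      (Cv.natAbs + (res + 10000)) ≤ G) :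
    (eA / one : ℝ) + eB / one + 2 * (eB / one) * (|1 - pAu / one| +
      |pAv / one| + ηA / one) + (|1 - pAu / one| + eA / one) *
      (|pBu / one| + eB / one) + (|1 - pBv / one| + eB / one) *
      (|pAv / one| + eA / one) + |K / one * (1 - pCu / one) - pBu / one| +
      |K / one * (pCv / one)| + res / one ≤ G / one := by
  have hU := one_pos
  have s1 := le_shiftRight (2 * eB * (dA + (A + ηA)))
  have s2 := le_shiftRight ((dA + eA) * (B + eB))
  have s3 := le_shiftRight ((dB + eB) * (A + eA))
  have s4 := le_shiftRight (K * (one - Cu) - one * Bu).natAbs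
  rw [Nat.cast_natAbs, Int.cast_abs] at s4
  have h' := (Nat.cast_le (α := ℝ)).2 h
  have hK' : (K : ℝ) ≤ one := by exact_mod_cast hK
  push_cast at h' s1 s2 s3 s4
  rw [Nat.cast_natAbs (α := ℝ) Cv] at h'
  push_cast at h'
  generalize (((2 * eB * (dA + (A + ηA))) >>> 200 : ℕ) : ℝ) = z1 at *
  generalize ((((dA + eA) * (B + eB)) >>> 200 : ℕ) : ℝ) = z2 at *
  generalize ((((dB + eB) * (A + eA)) >>> 200 : ℕ) : ℝ) = z3 at *
  generalize (((K * (one - Cu) - one * Bu).natAbs >>> 200 : ℕ) : ℝ) = z4 at *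
  have b1 : |1 - pAu / one| ≤ dA / one := by
    refine abs_sub_div_le hU ?_ hdA.ge
    rw [← abs_neg]; push_cast; convert hAu using 2; ring
  have b2 : |pAv / one| ≤ A / one := by
    rw [← abs_neg, ← zero_sub]
    refine abs_sub_div_le (y := -Av) hU ?_ (by rw [Int.natAbs_neg]; exact hA.ge)
    rw [← abs_neg]; push_cast; convert hAv using 2; ring
  have b3 : |pBu / one| ≤ B / one := by
    rw [← abs_neg, ← zero_sub]
    refine abs_sub_div_le (y := -Bu) hU ?_ (by rw [Int.natAbs_neg]; exact hB.ge)
    rw [← abs_neg]; push_cast; convert hBu using 2; ring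
  have b4 : |1 - pBv / one| ≤ dB / one := by
    refine abs_sub_div_le hU ?_ hdB.ge
    rw [← abs_neg]; push_cast; convert hBv using 2; ring
  clear hdA hA hB hdB h
  generalize (one : ℝ) = U at *
  have b5 : |K / U * (1 - pCu / U) - pBu / U| ≤ (z4 + 1025) / U := by
    have e : K / U * (1 - pCu / U) - pBu / U = ((K * (U - Cu) - U * Bu) / U +
        (K / U * (Cu - pCu) + (Bu - pBu))) / U := by
      field_simp; ring
    rw [e, abs_div, abs_of_pos hU]
    refine div_le_div_of_nonneg_right ?_ hU.le
    refine (abs_add_le _ _).trans ?_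
    have e1 : |(K * (U - Cu) - U * Bu) / U| ≤ z4 + 1 := by
      rw [abs_div, abs_of_pos hU]; exact s4
    have e2 : |K / U * (Cu - pCu)| ≤ 512 := by
      rw [abs_mul, abs_of_nonneg (by positivity : (0 : ℝ) ≤ K / U), abs_sub_comm]
      exact (mul_le_of_le_one_left (abs_nonneg _) ((div_le_one hU).2 hK')).trans hCu
    have e3 := abs_add_le (K / U * (Cu - pCu)) (Bu - pBu)
    rw [abs_sub_comm (Bu : ℝ)] at e3
    linarith
  have b6 : |K / U * (pCv / U)| ≤ (|(Cv : ℝ)| + 512) / U := by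
    rw [abs_mul, abs_of_nonneg (by positivity : (0 : ℝ) ≤ K / U)]
    refine (mul_le_of_le_one_left (abs_nonneg _) ((div_le_one hU).2 hK')).trans ?_
    rw [abs_div, abs_of_pos hU]
    refine div_le_div_of_nonneg_right ?_ hU.le
    have := abs_add_le (pCv - Cv) Cv
    rw [sub_add_cancel] at this
    linarith
  have c1 : 2 * (eB / U) * (|1 - pAu / U| + |pAv / U| + ηA / U) ≤ (z1 + 1) / U := by
    calc _ ≤ 2 * (eB / U) * (dA / U + A / U + ηA / U) := by gcongr
      _ = (2 * eB * (dA + (A + ηA)) / U) / U := by field_simp; ring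
      _ ≤ _ := div_le_div_of_nonneg_right s1 hU.le
  have c2 : (|1 - pAu / U| + eA / U) * (|pBu / U| + eB / U) ≤ (z2 + 1) / U := by
    calc _ ≤ (dA / U + eA / U) * (B / U + eB / U) := by gcongr
      _ = ((dA + eA) * (B + eB) / U) / U := by field_simp
      _ ≤ _ := div_le_div_of_nonneg_right s2 hU.le
  have c3 : (|1 - pBv / U| + eB / U) * (|pAv / U| + eA / U) ≤ (z3 + 1) / U := by
    calc _ ≤ (dB / U + eB / U) * (A / U + eA / U) := by gcongr
      _ = ((dB + eB) * (A + eA) / U) / U := by field_simp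
      _ ≤ _ := div_le_div_of_nonneg_right s3 hU.le
  have c4 : (eA + eB + (z1 + 1) + (z2 + 1) + (z3 + 1) + (z4 + 1025) + (|(Cv : ℝ)| + 512) + res) / U ≤
      G / U := div_le_div_of_nonneg_right (by linarith) hU.le
  simp only [add_div] at b5 b6 c1 c2 c3 c4 ⊢
  linarith

/-- Numerator of the derivative recursion, `p_A * p_B'`, as an integer polynomial. -/
def prodPoly (a : ℤ) (ta tb : CoeffTree) : ℤ[X] := (C a + X * toPoly ta) * derivPoly tb 1

theorem coeff_prodPoly_le (a : ℤ) (ta tb : CoeffTree) (j : ℕ) :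
    |(prodPoly a ta tb).coeff j| ≤ (a.natAbs + l1 ta) * derivL1 tb 1 := by
  have e : prodPoly a ta tb = C a * derivPoly tb 1 + X ^ 1 * (toPoly ta * derivPoly tb 1) := by
    rw [prodPoly]; ring
  rw [e, coeff_add, coeff_C_mul, add_mul]
  refine (abs_add_le _ _).trans (add_le_add ?_ ?_)
  · rw [abs_mul, Int.natCast_natAbs]
    exact mul_le_mul_of_nonneg_left (coeff_derivPoly_le tb 1 j) (abs_nonneg _)
  · exact coeff_X_pow_mul_le (coeff_toPoly_mul_le (coeff_derivPoly_le tb 1) ta) 1 j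

/-- The packed product. -/
def packedProd (W d : ℕ) (a : ℤ) (ta tb : CoeffTree) : ℤ :=
  (a + shl (pack W ta) W) * derivPack W tb 1 + offset W (d + 1)

theorem unpack_eq_prodPoly {W d : ℕ} {a : ℤ} {ta tb : CoeffTree} (hW : 1 ≤ W)
    (h0 : 0 ≤ packedProd W d a ta tb)
    (hlt : (packedProd W d a ta tb).toNat / 2 ^ (W * 2 ^ d) < 2 ^ (W * 2 ^ d))
    (hH : (a.natAbs + l1 ta) * derivL1 tb 1 < 2 ^ (W - 1)) :
    unpack W (2 ^ (W - 1)) (d + 1) (packedProd W d a ta tb).toNat = prodPoly a ta tb := by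
  have hv : (packedProd W d a ta tb).toNat < 2 ^ (W * 2 ^ (d + 1)) := by
    rw [Nat.div_lt_iff_lt_mul (by positivity), ← pow_add] at hlt
    convert hlt using 2; ring
  refine eq_of_eval_eq (N := 2 ^ W) (by positivity) (fun j => ?_) ?_
  · have h1 := coeff_unpack_le hW hv j
    have h2 := coeff_prodPoly_le a ta tb j
    have h3 : ((a.natAbs + l1 ta) * derivL1 tb 1 : ℤ) < 2 ^ (W - 1) := by exact_mod_cast hH
    have h4 : (2 : ℤ) ^ W = 2 ^ (W - 1) + 2 ^ (W - 1) := by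
      rw [← mul_two, ← pow_succ, Nat.sub_add_cancel hW]
    rw [h4]
    exact (abs_sub _ _).trans_lt (add_lt_add_of_le_of_lt h1 (h2.trans_lt h3))
  · have h1 := eval_unpack W (d + 1) (packedProd W d a ta tb).toNat
    rw [Int.toNat_of_nonneg h0, packedProd, add_left_inj, shl_eq, pack_eq, derivPack_eq] at h1
    rw [packedProd, shl_eq, pack_eq, derivPack_eq, h1, prodPoly]
    simp only [eval_mul, eval_add, eval_C, eval_X]
    ring

theorem residual_le {W d K ρ e V : ℕ} {a : ℤ} {ta tb : CoeffTree} {s : ℝ} (hK : 0 < K) (hK' : K ≤ one)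
    (he : e = 2 ^ d)
    (hV : unpack W (2 ^ (W - 1)) (d + 1) V = prodPoly a ta tb) (hs : |s| ≤ ρ / 4096) (hs' : |s| ≤ 1) :
    |K * aeval s (derivPoly (mkT W (2 ^ (W - 1)) K d 1 (V % 2 ^ (W * e))) 1) +
      (a + s * aeval s (toPoly ta)) * aeval s (derivPoly tb 1)| ≤
      one * (e * e + tailBound W (2 ^ (W - 1)) ρ d e (V / 2 ^ (W * e)) : ℕ) := by
  have hU := one_pos
  have h1 : aeval s (prodPoly a ta tb) = (a + s * aeval s (toPoly ta)) * aeval s (derivPoly tb 1) := by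
    simp [prodPoly]
  rw [← h1, ← hV, unpack, he]
  simp only [map_add, map_mul, map_pow, aeval_X]
  have h2 := abs_residual_le (W := W) (H := 2 ^ (W - 1)) (d := d) (v := V % 2 ^ (W * 2 ^ d)) hK
    Nat.one_pos hs'
  have h3 := mul_pow_le_div (e := 2 ^ d) (abs_aeval_unpack_le (W := W) (H := 2 ^ (W - 1)) hs d
    (V / 2 ^ (W * 2 ^ d))) hs
  have e1 : tailBound W (2 ^ (W - 1)) ρ d (2 ^ d) (V / 2 ^ (W * 2 ^ d)) =
      (hb W (2 ^ (W - 1)) ρ d (V / 2 ^ (W * 2 ^ d)) * ρ ^ 2 ^ d / 2 ^ (12 * 2 ^ d) + 1) >>> 200 + 1 := by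
    rw [← Nat.shiftRight_eq_div_pow (hb _ _ _ _ _ * _)]; rfl
  rw [e1]
  generalize hb W (2 ^ (W - 1)) ρ d (V / 2 ^ (W * 2 ^ d)) * ρ ^ 2 ^ d / 2 ^ (12 * 2 ^ d) = z at h3 ⊢
  have h4 := le_shiftRight (z + 1)
  rw [div_le_iff₀ hU] at h4
  have h5 : (K : ℝ) * (2 ^ d * ((1 : ℕ) + 2 ^ d - 1)) ≤ one * (2 ^ d * 2 ^ d) := by
    have : (K : ℝ) ≤ one := by exact_mod_cast hK'
    have e : ((1 : ℕ) : ℝ) + 2 ^ d - 1 = 2 ^ d := by push_cast; ring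
    rw [e]
    gcongr
  rw [← add_assoc]
  refine (abs_add_le _ _).trans ?_
  push_cast at h4 ⊢
  linarith

/-- The function on the window represented by a constant coefficient and a tree. -/
def approx (a : ℤ) (t : CoeffTree) (x : ℝ) : ℝ :=
  (a + (x - 2471 / 4096) * aeval (x - 2471 / 4096 : ℝ) (toPoly t)) / one

/-- The derivative of `approx a t`. -/
def approxDeriv (t : CoeffTree) (x : ℝ) : ℝ := aeval (x - 2471 / 4096 : ℝ) (derivPoly t 1) / one

theorem hasDerivAt_approx (a : ℤ) (t : CoeffTree) (x : ℝ) :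
    HasDerivAt (approx a t) (approxDeriv t x) x := by
  have h1 : HasDerivAt (fun s : ℝ => aeval s (C a + X * toPoly t))
      (aeval (x - 2471 / 4096 : ℝ) (derivPoly t 1)) (x - 2471 / 4096) := by
    have h2 := (C a + X * toPoly t).hasDerivAt_aeval (x - 2471 / 4096 : ℝ)
    have h3 := derivative_toPoly t 0
    rw [derivative_add, derivative_C, zero_add] at h2
    simp only [zero_add, pow_one, pow_zero, one_mul] at h3
    rwa [h3] at h2
  have h4 := (h1.comp_sub_const x _).div_const (one : ℝ)
  have e : approx a t = fun x => aeval (x - 2471 / 4096 : ℝ) (C a + X * toPoly t) / one := by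
    ext y; simp [approx]
  rw [e]
  exact h4

/-- The coefficient tree constructed by `step`. -/
def nextTree (S : StepState) (k : Cert) : CoeffTree :=
  mkT k.W (2 ^ (k.W - 1)) k.K k.d 1 ((packedProd k.W k.d S.a S.ta S.tb).toNat % 2 ^ (k.W * 2 ^ k.d))

/-- The bound for the residual used by `step`. -/
def resBound (S : StepState) (k : Cert) : ℕ :=
  2 ^ k.d * 2 ^ k.d + tailBound k.W (2 ^ (k.W - 1)) (k.L + (k.R - k.L)) k.d (2 ^ k.d)
    ((packedProd k.W k.d S.a S.ta S.tb).toNat / 2 ^ (k.W * 2 ^ k.d))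

/-- The state reached by `step`. -/
def nextState (S : StepState) (k : Cert) : StepState :=
  ⟨S.b, S.tb, k.c, nextTree S k, S.eB, 36 * k.G / 5 + 1, S.ηB, k.η, k.L, k.R⟩

/-- The first end of the window, relative to its centre and multiplied by `4096`. -/
def fstEnd (k : Cert) : Bool → ℤ
  | true => -k.L
  | false => k.R

/-- The second end of the window, relative to its centre and multiplied by `4096`. -/
def sndEnd (k : Cert) : Bool → ℤ
  | true => k.R
  | false => -k.L

/-- The facts established by a successful `step`. -/
structure StepSpec (S : StepState) (k : Cert) (f : StepState → Bool) (mu mv : ℤ) : Prop where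
  nonneg : 0 ≤ packedProd k.W k.d S.a S.ta S.tb
  lt : (packedProd k.W k.d S.a S.ta S.tb).toNat / 2 ^ (k.W * 2 ^ k.d) < 2 ^ (k.W * 2 ^ k.d)
  W1 : 1 ≤ k.W
  d9 : k.d ≤ 9
  hL : k.L ≤ S.L
  hR : k.R ≤ S.R
  hH : (S.a.natAbs + l1 S.ta) * derivL1 S.tb 1 < 2 ^ (k.W - 1)
  final : finalCheck S k (resBound S k) (eval mu S.a S.ta) (eval mv S.a S.ta)
    (eval mu S.b S.tb) (eval mv S.b S.tb) (eval mu k.c (nextTree S k))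
    (eval mv k.c (nextTree S k)) = true
  next : f (nextState S k) = true

theorem step_spec {odd : Bool} {S : StepState} {k : Cert} {f : StepState → Bool} (h : step odd S k f = true) :
    StepSpec S k f (fstEnd k odd) (sndEnd k odd) := by
  unfold step at h
  simp only [force_eq, forceZ_eq, mk_eq, Bool.and_eq_true] at h
  obtain ⟨h1, h2, h3, h4, h5, h6, h7, h8, h9⟩ := h
  have hV : ∀ V : ℕ, V - ((V >>> (k.W * 2 ^ k.d)) <<< (k.W * 2 ^ k.d)) = V % 2 ^ (k.W * 2 ^ k.d) :=
    fun V => sub_shiftLeft_shiftRight V _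
  have hV' := Nat.shiftRight_eq_div_pow (packedProd k.W k.d S.a S.ta S.tb).toNat (k.W * 2 ^ k.d)
  have e1 : nextTree S k = mkT k.W (2 ^ (k.W - 1)) k.K k.d 1
      ((packedProd k.W k.d S.a S.ta S.tb).toNat - (((packedProd k.W k.d S.a S.ta S.tb).toNat >>>
        (k.W * 2 ^ k.d)) <<< (k.W * 2 ^ k.d))) := by rw [hV]; rfl
  have e2 : resBound S k = 2 ^ k.d * 2 ^ k.d +
      tailBound k.W (2 ^ (k.W - 1)) (k.L + (k.R - k.L)) k.d (2 ^ k.d)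
    ((packedProd k.W k.d S.a S.ta S.tb).toNat >>> (k.W * 2 ^ k.d)) := by rw [hV']; rfl
  refine ⟨(nonneg_iff _).1 h1, ?_, Nat.le_of_ble_eq_true h3, Nat.le_of_ble_eq_true h4,
    Nat.le_of_ble_eq_true h5, Nat.le_of_ble_eq_true h6, Nat.le_of_ble_eq_true h7, ?_, ?_⟩
  · have h2' : ((packedProd k.W k.d S.a S.ta S.tb).toNat >>> (k.W * 2 ^ k.d)) >>>
        (k.W * 2 ^ k.d) + 1 ≤ 1 := Nat.le_of_ble_eq_true h2
    rw [Nat.shiftRight_eq_div_pow, Nat.shiftRight_eq_div_pow] at h2'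
    have h0 : (0 : ℕ) < 2 ^ (k.W * 2 ^ k.d) := by positivity
    exact (Nat.div_eq_zero_iff_lt h0).1 (by lia)
  · rw [e1, e2]; cases odd <;> exact h8
  · rw [nextState, e1]; exact h9

theorem finalCheck_spec {S : StepState} {k : Cert} {res : ℕ} {Au Av Bu Bv Cu Cv : ℤ}
    (h : finalCheck S k res Au Av Bu Bv Cu Cv = true) :
    (S.eA + (S.eB + (2 * S.eB * (((one - Au).natAbs + 1024) + ((Av.natAbs + 1024) + S.ηA))) >>> 200) +
      (((((one - Au).natAbs + 1024) + S.eA) * ((Bu.natAbs + 1024) + S.eB)) >>> 200 +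
      (((((one - Bv).natAbs + 1024) + S.eB) * ((Av.natAbs + 1024) + S.eA)) >>> 200 +
      (k.K * (one - Cu) - one * Bu).natAbs >>> 200)) + (Cv.natAbs + (res + 10000)) ≤ k.G) ∧
    8 * S.ηB + 4 * res ≤ k.η ∧ (k.η + 1024 : ℕ) ≤ Cv ∧ Cu + (k.η + 1024 : ℕ) ≤ 2 * one ∧
    5 * one + 18 * k.G ≤ 18 * k.K ∧ k.K ≤ one := by
  unfold finalCheck at h
  simp only [Bool.and_eq_true] at h
  obtain ⟨h1, h2, h3, h4, h5, h6⟩ := h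
  refine ⟨(add_assoc _ _ _).trans_le (Nat.le_of_ble_eq_true h1), Nat.le_of_ble_eq_true h2, ?_, ?_, Nat.le_of_ble_eq_true h5,
    Nat.le_of_ble_eq_true h6⟩
  · exact sub_nonneg.1 ((nonneg_iff _).1 h3)
  · have h7 : Cu + (k.η + 1024 : ℕ) ≤ ((2 * one : ℕ) : ℤ) := sub_nonneg.1 ((nonneg_iff _).1 h4)
    rw [Nat.cast_mul] at h7
    exact h7

/-- The window around `2471 / 4096`. -/
def window (L R : ℕ) : Set ℝ := Icc ((2471 - L) / 4096) ((2471 + R) / 4096)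

theorem window_mono {L R L' R' : ℕ} (hL : L ≤ L') (hR : R ≤ R') : window L R ⊆ window L' R' := by
  have h1 : (L : ℝ) ≤ L' := by exact_mod_cast hL
  have h2 : (R : ℝ) ≤ R' := by exact_mod_cast hR
  exact Icc_subset_Icc (by linarith) (by linarith)

/-- The sign of `-(q n)'` for `n` odd or even. -/
def sgn : Bool → ℝ
  | true => 1
  | false => -1

/-- The reflection of `[0, 1]` used for even `n`. -/
def flip : Bool → ℝ → ℝ
  | true => fun x => x
  | false => fun x => 1 - x

/-- The state `S` describes approximations of `A` and `B`. -/
structure Inv (odd : Bool) (S : StepState) (A B : ℝ → ℝ) : Prop where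
  hL : S.L ≤ 2471
  hR : S.R ≤ 1625
  cntA : cnt S.ta ≤ 512
  cntB : cnt S.tb ≤ 512
  errA : ∀ x ∈ window S.L S.R, |A x - approx S.a S.ta x| ≤ S.eA / one
  errB : ∀ x ∈ window S.L S.R, |B x - approx S.b S.tb x| ≤ S.eB / one
  memA : ∀ x ∈ window S.L S.R, 0 ≤ approx S.a S.ta x ∧ approx S.a S.ta x ≤ 2
  memB : ∀ x ∈ window S.L S.R, 0 ≤ approx S.b S.tb x ∧ approx S.b S.tb x ≤ 2
  derivA : ∀ x ∈ window S.L S.R, sgn odd * approxDeriv S.ta x ≤ S.ηA / one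
  derivB : ∀ x ∈ window S.L S.R, -(S.ηB / one) ≤ sgn odd * approxDeriv S.tb x

theorem abs_one_mul_approx_sub_le {m a : ℤ} {t : CoeffTree} {x : ℝ} (hm : |m| ≤ 4096)
    (hx : x = (2471 + m) / 4096) (ht : cnt t ≤ 512) :
    |one * approx a t x - eval m a t| ≤ 512 := by
  have h1 := abs_aeval_sub_eval_le hm a t
  have e : x - 2471 / 4096 = m / 4096 := by rw [hx]; ring
  rw [approx, e, mul_div_cancel₀ _ one_pos.ne']
  exact h1.trans (by exact_mod_cast ht)

theorem hasDerivAt_flip (odd : Bool) (x : ℝ) : HasDerivAt (flip odd) (sgn odd) x := by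
  cases odd
  · exact (hasDerivAt_id x).const_sub 1
  · exact hasDerivAt_id x

theorem flip_flip (odd : Bool) (x : ℝ) : flip odd (flip odd x) = x := by
  cases odd <;> simp [flip]

theorem abs_sub_center_le {L R : ℕ} {x : ℝ} (hx : x ∈ window L R) :
    |x - 2471 / 4096| ≤ (L + (R - L) : ℕ) / 4096 := by
  obtain ⟨h1, h2⟩ := hx
  have h3 : (L : ℝ) ≤ (L + (R - L) : ℕ) := by exact_mod_cast Nat.le_add_right _ _
  have h4 : (R : ℝ) ≤ (L + (R - L) : ℕ) := by exact_mod_cast by lia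
  rw [abs_le]
  constructor <;> linarith

section Soundness

variable {odd : Bool} {S : StepState} {k : Cert} {f : StepState → Bool} {A B C B' : ℝ → ℝ} {c : ℝ}

theorem K_pos (h : 5 * one + 18 * k.G ≤ 18 * k.K) : 0 < k.K := by
  have : 0 < one := by rw [one_eq]; positivity
  lia

theorem residual_window (h : StepSpec S k f (fstEnd k odd) (sndEnd k odd)) (I : Inv odd S A B)
    {x : ℝ} (hx : x ∈ window k.L k.R) :
    |k.K / one * approxDeriv (nextTree S k) x + approx S.a S.ta x * approxDeriv S.tb x| ≤
      resBound S k / one := by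
  obtain ⟨-, -, -, -, h5, h6⟩ := finalCheck_spec h.final
  have hs := abs_sub_center_le hx
  have hs' : |x - 2471 / 4096| ≤ 1 := by
    refine hs.trans ?_
    rw [div_le_one (by norm_num)]
    have := h.hL
    have := h.hR
    have := I.hL
    have := I.hR
    have : k.L + (k.R - k.L) ≤ 4096 := by lia
    exact_mod_cast this
  have hr := residual_le (K_pos h5) h6 rfl (unpack_eq_prodPoly h.W1 h.nonneg h.lt h.hH) hs hs'
  have hU := one_pos
  have e : k.K / one * approxDeriv (nextTree S k) x + approx S.a S.ta x * approxDeriv S.tb x =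
      (k.K * aeval (x - 2471 / 4096 : ℝ) (derivPoly (nextTree S k) 1) +
      (S.a + (x - 2471 / 4096) * aeval (x - 2471 / 4096 : ℝ) (toPoly S.ta)) *
        aeval (x - 2471 / 4096 : ℝ) (derivPoly S.tb 1)) / one / one := by
    rw [approxDeriv, approxDeriv, approx]; field_simp
  rw [e, abs_div, abs_div, abs_of_pos hU]
  refine div_le_div_of_nonneg_right ?_ hU.le
  rw [div_le_iff₀ hU, mul_comm (resBound S k : ℝ)]
  exact hr

/-- The window in reflected coordinates. -/
theorem ends_spec (k : Cert) (odd : Bool) (hL : k.L ≤ 2471) (hR : k.R ≤ 1625) :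
    ∃ u v : ℝ, 0 ≤ u ∧ u ≤ v ∧ v ≤ 1 ∧ flip odd u = (2471 + fstEnd k odd) / 4096 ∧
      flip odd v = (2471 + sndEnd k odd) / 4096 ∧
      (∀ x ∈ Icc u v, flip odd x ∈ window k.L k.R) ∧
      (∀ x ∈ window k.L k.R, flip odd x ∈ Icc u v) := by
  have h1 : (k.L : ℝ) ≤ 2471 := by exact_mod_cast hL
  have h2 : (k.R : ℝ) ≤ 1625 := by exact_mod_cast hR
  have h3 : (0 : ℝ) ≤ k.L := Nat.cast_nonneg _
  have h4 : (0 : ℝ) ≤ k.R := Nat.cast_nonneg _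
  cases odd
  · refine ⟨1 - (2471 + k.R) / 4096, 1 - (2471 - k.L) / 4096, by linarith, by linarith, by linarith,
      ?_, ?_, fun x hx => ?_, fun x hx => ?_⟩
    · simp [flip, fstEnd]
    · simp [flip, sndEnd]; ring
    · exact ⟨by simp only [flip]; linarith [hx.2], by simp only [flip]; linarith [hx.1]⟩
    · exact ⟨by simp only [flip]; linarith [hx.2], by simp only [flip]; linarith [hx.1]⟩
  · refine ⟨(2471 - k.L) / 4096, (2471 + k.R) / 4096, by linarith, by linarith, by linarith,
      ?_, ?_, fun x hx => hx, fun x hx => hx⟩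
    · simp [flip, fstEnd]; ring
    · simp [flip, sndEnd]

theorem step_sound (h : step odd S k f = true) (I : Inv odd S A B)
    (H : StepData (A ∘ flip odd) (B ∘ flip odd) (C ∘ flip odd) B' c) :
    |c - k.K / one| ≤ k.G / one ∧ ∃ S', f S' = true ∧ Inv (!odd) S' B C := by
  have hS := step_spec h
  obtain ⟨h1, h2, h3, h4, h5, h6⟩ := finalCheck_spec hS.final
  have hU := one_pos
  have hwin := window_mono hS.hL hS.hR
  have hL := hS.hL.trans I.hL
  have hR := hS.hR.trans I.hR
  obtain ⟨u, v, u0, uv, v1, hu, hv, hin, hout⟩ := ends_spec k odd hL hR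
  have hmu : |fstEnd k odd| ≤ 4096 := by cases odd <;> simp [fstEnd] <;> lia
  have hmv : |sndEnd k odd| ≤ 4096 := by cases odd <;> simp [sndEnd] <;> lia
  have hcnt : cnt (nextTree S k) ≤ 512 := by
    rw [nextTree, cnt_mkT]
    exact (pow_le_pow_right₀ (by norm_num) hS.d9).trans_eq (by norm_num)
  have bAu := abs_one_mul_approx_sub_le (a := S.a) hmu hu I.cntA
  have bAv := abs_one_mul_approx_sub_le (a := S.a) hmv hv I.cntA
  have bBu := abs_one_mul_approx_sub_le (a := S.b) hmu hu I.cntB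
  have bBv := abs_one_mul_approx_sub_le (a := S.b) hmv hv I.cntB
  have bCu := abs_one_mul_approx_sub_le (a := k.c) hmu hu hcnt
  have bCv := abs_one_mul_approx_sub_le (a := k.c) hmv hv hcnt
  have hG := error_le bAu bAv bBu bBv bCu bCv rfl rfl rfl rfl h6 h1
  simp only [mul_div_cancel_left₀ _ hU.ne'] at hG
  have h5' : (5 * one + 18 * k.G : ℝ) ≤ 18 * k.K := by exact_mod_cast h5
  have hd : ∀ a t x, HasDerivAt (approx a t ∘ flip odd) (approxDeriv t (flip odd x) * sgn odd) x :=
    fun a t x => (hasDerivAt_approx a t _).comp x (hasDerivAt_flip odd x)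
  have hAp : StepApprox (A ∘ flip odd) (B ∘ flip odd) (approx S.a S.ta ∘ flip odd)
      (approx S.b S.tb ∘ flip odd) (approx k.c (nextTree S k) ∘ flip odd)
      (fun x => approxDeriv S.ta (flip odd x) * sgn odd)
      (fun x => approxDeriv S.tb (flip odd x) * sgn odd)
      (fun x => approxDeriv (nextTree S k) (flip odd x) * sgn odd)
      (k.K / one) u v (S.eA / one) (S.eB / one) (S.ηA / one) (S.ηB / one) (k.η / one)
      (resBound S k / one) :=
    { u0 := u0
      uv := uv
      v1 := v1
      K0 := by
        rw [div_le_div_iff₀ (by norm_num) hU]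
        have : (0 : ℝ) ≤ k.G := Nat.cast_nonneg _
        linarith
      ηA0 := by positivity
      ηB0 := by positivity
      derivPA := hd _ _
      derivPB := hd _ _
      derivPC := hd _ _
      errA := fun x hx => I.errA _ (hwin (hin x hx))
      errB := fun x hx => I.errB _ (hwin (hin x hx))
      PA0 := fun x hx => (I.memA _ (hwin (hin x hx))).1
      PA2 := fun x hx => (I.memA _ (hwin (hin x hx))).2
      derivPA_le := fun x hx => by
        rw [mul_comm]; exact I.derivA _ (hwin (hin x hx))
      le_derivPB := fun x hx => by
        rw [mul_comm]; exact I.derivB _ (hwin (hin x hx))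
      res := fun x hx => by
        have hs : |sgn odd| = 1 := by cases odd <;> norm_num [sgn]
        have := residual_window hS I (hin x hx)
        rw [← mul_one |_|, ← hs, ← abs_mul, add_mul, mul_assoc, mul_assoc] at this
        exact this
      hηC := by
        have h2' : (8 * S.ηB + 4 * resBound S k : ℝ) ≤ k.η := by exact_mod_cast h2
        rw [← mul_div_assoc, ← mul_div_assoc, ← add_div]
        exact div_le_div_of_nonneg_right h2' hU.le
      PCv := by
        have h3' : (k.η + 1024 : ℝ) ≤ eval (sndEnd k odd) k.c (nextTree S k) := by exact_mod_cast h3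
        rw [div_le_iff₀ hU, mul_comm]
        have := (abs_le.1 bCv).1
        simp only [Function.comp]
        linarith
      PCu := by
        have h4' : (eval (fstEnd k odd) k.c (nextTree S k) + (k.η + 1024) : ℝ) ≤ 2 * one := by
          exact_mod_cast h4
        have := (abs_le.1 bCu).2
        simp only [Function.comp]
        rw [← le_sub_iff_add_le', div_le_iff₀ hU]
        linarith }
  obtain ⟨hc, hC⟩ := hAp.bound H hG
  refine ⟨hc, nextState S k, hS.next, ?_⟩
  have hflip : ∀ x ∈ window k.L k.R, ∃ y ∈ Icc u v, flip odd y = x :=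
    fun x hx => ⟨flip odd x, hout x hx, flip_flip odd x⟩
  have hsgn : sgn (!odd) = -sgn odd := by cases odd <;> simp [sgn]
  exact
    { hL := hL
      hR := hR
      cntA := I.cntB
      cntB := hcnt
      errA := fun x hx => I.errB x (hwin hx)
      errB := fun x hx => by
        obtain ⟨y, hy, rfl⟩ := hflip x hx
        have h7 := hC y hy
        have h8 : 5 / 18 ≤ c := by
          have h9 := (abs_le.1 hc).1
          have : (5 / 18 : ℝ) ≤ k.K / one - k.G / one := by
            rw [← sub_div, le_div_iff₀ hU]; linarith
          linarith
        have h9 : |C (flip odd y) - approx k.c (nextTree S k) (flip odd y)| ≤ 36 / 5 * (k.G / one) := by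
          have := mul_le_mul_of_nonneg_right h8
            (abs_nonneg (C (flip odd y) - approx k.c (nextTree S k) (flip odd y)))
          simp only [Function.comp] at h7
          linarith
        refine h9.trans ?_
        rw [← mul_div_assoc]
        refine div_le_div_of_nonneg_right ?_ hU.le
        have : (36 * k.G : ℕ) ≤ 5 * (36 * k.G / 5 + 1) := by lia
        have : (36 * k.G : ℝ) ≤ 5 * ((36 * k.G / 5 + 1 : ℕ) : ℝ) := by exact_mod_cast this
        simp only [nextState]
        linarith
      memA := fun x hx => I.memB x (hwin hx)
      memB := fun x hx => by
        obtain ⟨y, hy, rfl⟩ := hflip x hx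
        exact hAp.PC_mem hy
      derivA := fun x hx => by
        have := I.derivB x (hwin hx)
        rw [hsgn]
        simp only [nextState]
        linarith
      derivB := fun x hx => by
        obtain ⟨y, hy, rfl⟩ := hflip x hx
        have := hAp.deriv_le hy
        rw [hsgn]
        simp only [nextState]
        linarith }

theorem run_cons (k : Cert) (l : List Cert) (odd : Bool) (S : StepState) :
    run (k :: l) odd S = step odd S k (run l (!odd)) := rfl

/-- Soundness of the checker for a sequence of functions following the recursion. -/
theorem run_sound {p : ℕ → ℝ → ℝ} {c : ℕ → ℝ} {D : ℕ → ℝ → ℝ} {par : ℕ → Bool}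
    (hpar : ∀ n, par (n + 1) = !par n)
    (H : ∀ n, StepData (p n ∘ flip (par n)) (p (n + 1) ∘ flip (par n)) (p (n + 2) ∘ flip (par n))
      (D n) (c n)) (l : List Cert) (n : ℕ) (S : StepState) (hr : run l (par n) S = true)
    (I : Inv (par n) S (p n) (p (n + 1))) (i : ℕ) (hi : i < l.length) :
    |c (n + i) - l[i].K / one| ≤ l[i].G / one := by
  induction l generalizing n S i with
  | nil => exact absurd hi (Nat.not_lt_zero _)
  | cons k l ih =>
    rw [run_cons] at hr
    obtain ⟨h1, S', h2, h3⟩ := step_sound hr I (H n)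
    cases i with
    | zero => exact h1
    | succ i =>
      rw [← hpar] at h2 h3
      have := ih (n + 1) S' h2 h3 i (Nat.lt_of_succ_lt_succ hi)
      rwa [add_assoc, add_comm 1 i] at this

theorem inv_start {A B : ℝ → ℝ} (hA : ∀ x ∈ Icc (0 : ℝ) 1, A x = x)
    (hB : ∀ x ∈ Icc (0 : ℝ) 1, B x = 1 - x) : Inv false start A B := by
  have hU := one_pos.ne'
  have e0 : ∀ x, approx start.a start.ta x = x := fun x => by
    have h1 : start.a = ((2471 * 2 ^ 188 : ℕ) : ℤ) := by
      rw [← Nat.shiftLeft_eq]; rfl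
    have h2 : start.ta = leaf one := rfl
    have h3 : ((2471 * 2 ^ 188 : ℕ) : ℝ) = 2471 / 4096 * one := by
      rw [one_eq]; push_cast; norm_num
    rw [approx, h1, h2, Int.cast_natCast, h3]
    simp only [toPoly, map_natCast]
    field_simp; ring
  have e1 : ∀ x, approx start.b start.tb x = 1 - x := fun x => by
    have h1 : start.b = ((1625 * 2 ^ 188 : ℕ) : ℤ) := by
      rw [← Nat.shiftLeft_eq]; rfl
    have h2 : start.tb = leaf (-one) := rfl
    have h3 : ((1625 * 2 ^ 188 : ℕ) : ℝ) = 1625 / 4096 * one := by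
      rw [one_eq]; push_cast; norm_num
    rw [approx, h1, h2, Int.cast_natCast, h3]
    simp only [toPoly, map_neg, map_natCast]
    field_simp; ring
  have d0 : ∀ x, approxDeriv start.ta x = 1 := fun x => by
    have h2 : start.ta = leaf one := rfl
    rw [approxDeriv, h2]
    simp [derivPoly, hU]
  have d1 : ∀ x, approxDeriv start.tb x = -1 := fun x => by
    have h2 : start.tb = leaf (-one) := rfl
    rw [approxDeriv, h2]
    simp [derivPoly, hU]
  have hw : ∀ x ∈ window start.L start.R, x ∈ Icc (0 : ℝ) 1 := fun x hx => by
    have h3 : start.L = 2471 := rfl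
    have h4 : start.R = 1625 := rfl
    rw [h3, h4] at hx
    obtain ⟨h1, h2⟩ := hx
    push_cast at h1 h2
    constructor <;> linarith
  have z1 : start.eA = 0 := rfl
  have z2 : start.eB = 0 := rfl
  have z3 : start.ηA = 0 := rfl
  have z4 : start.ηB = 0 := rfl
  constructor
  · exact le_rfl
  · exact le_rfl
  · exact show 1 ≤ 512 by norm_num
  · exact show 1 ≤ 512 by norm_num
  · intro x hx; rw [e0, hA x (hw x hx), z1]; simp
  · intro x hx; rw [e1, hB x (hw x hx), z2]; simp
  · intro x hx; rw [e0]; have := hw x hx; constructor <;> linarith [this.1, this.2]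
  · intro x hx; rw [e1]; have := hw x hx; constructor <;> linarith [this.1, this.2]
  · intro x hx; rw [d0, z3]; simp [sgn]
  · intro x hx; rw [d1, z4]; simp [sgn]

end Soundness

end CoeffTree

/-! ### Pseudo-inverses -/

namespace Stribolic

open Filter Topology

variable {f g : ℝ → ℝ}

theorem pseudoInv_nonneg (f : ℝ → ℝ) (y : ℝ) : 0 ≤ pseudoInv f y :=
  Real.sSup_nonneg fun _ hx => hx.1.1

theorem pseudoInv_le_one (f : ℝ → ℝ) (y : ℝ) : pseudoInv f y ≤ 1 :=
  Real.sSup_le (fun _ hx => hx.1.2) zero_le_one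

theorem bddAbove_superlevel (f : ℝ → ℝ) (y : ℝ) : BddAbove {x | x ∈ Icc (0 : ℝ) 1 ∧ y ≤ f x} :=
  ⟨1, fun _ hx => hx.1.2⟩

theorem le_pseudoInv {x y : ℝ} (hx : x ∈ Icc (0 : ℝ) 1) (h : y ≤ f x) : x ≤ pseudoInv f y :=
  le_csSup (bddAbove_superlevel f y) ⟨hx, h⟩

theorem pseudoInv_antitone (f : ℝ → ℝ) : Antitone (pseudoInv f) := by
  intro y z hyz
  exact Real.sSup_le (fun x hx => le_pseudoInv hx.1 (hyz.trans hx.2)) (pseudoInv_nonneg f y)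

theorem pseudoInv_eq_zero {y : ℝ} (h : ∀ x ∈ Icc (0 : ℝ) 1, f x < y) : pseudoInv f y = 0 := by
  have : {x | x ∈ Icc (0 : ℝ) 1 ∧ y ≤ f x} = ∅ := by
    ext x; simp only [mem_ofPred_eq, mem_empty_iff_false, iff_false]
    exact fun hx => (h x hx.1).not_ge hx.2
  rw [pseudoInv, this, Real.sSup_empty]

theorem le_of_lt_pseudoInv (hf : AntitoneOn f (Icc 0 1)) {v y : ℝ} (hv : 0 ≤ v)
    (h : v < pseudoInv f y) : y ≤ f v := by
  have hne : {x | x ∈ Icc (0 : ℝ) 1 ∧ y ≤ f x}.Nonempty := by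
    by_contra hne
    rw [pseudoInv, not_nonempty_iff_eq_empty.1 hne, Real.sSup_empty] at h
    linarith
  obtain ⟨x, hx, hvx⟩ := exists_lt_of_lt_csSup hne h
  exact hx.2.trans (hf ⟨hv, hvx.le.trans hx.1.2⟩ hx.1 hvx.le)

theorem lt_of_pseudoInv_lt {v y : ℝ} (hv : v ∈ Icc (0 : ℝ) 1) (h : pseudoInv f y < v) :
    f v < y := by
  by_contra! hc
  exact (le_pseudoInv hv hc).not_gt h

theorem pseudoInv_intervalIntegrable (f : ℝ → ℝ) (a b : ℝ) :
    IntervalIntegrable (pseudoInv f) volume a b :=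
  (pseudoInv_antitone f).intervalIntegrable

theorem integral_pseudoInv (hf : AntitoneOn f (Icc 0 1)) (hm : MapsTo f (Icc 0 1) (Icc 0 1)) :
    ∫ t in (0 : ℝ)..1, pseudoInv f t = ∫ t in (0 : ℝ)..1, f t := by
  have hi : IntervalIntegrable f volume 0 1 :=
    AntitoneOn.intervalIntegrable (by rwa [uIcc_of_le zero_le_one])
  rw [intervalIntegral.integral_of_le zero_le_one, intervalIntegral.integral_of_le zero_le_one]
  have hpos : 0 ≤ᵐ[volume.restrict (Ioc 0 1)] f := by
    filter_upwards [ae_restrict_mem measurableSet_Ioc] with x hx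
    exact (hm (Ioc_subset_Icc_self hx)).1
  rw [((intervalIntegrable_iff_integrableOn_Ioc_of_le zero_le_one).1 hi).integral_eq_integral_meas_le
    hpos]
  have key : ∀ t, 0 < t →
      (volume.restrict (Ioc (0 : ℝ) 1)).real {a | t ≤ f a} = pseudoInv f t := by
    intro t ht
    rw [measureReal_restrict_apply' measurableSet_Ioc]
    have h1 : Ioo 0 (pseudoInv f t) ⊆ {a | t ≤ f a} ∩ Ioc 0 1 := fun x hx =>
      ⟨le_of_lt_pseudoInv hf hx.1.le hx.2, hx.1, hx.2.le.trans (pseudoInv_le_one f t)⟩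
    have h2 : {a | t ≤ f a} ∩ Ioc 0 1 ⊆ Ioc 0 (pseudoInv f t) := fun x hx =>
      ⟨hx.2.1, le_pseudoInv (Ioc_subset_Icc_self hx.2) hx.1⟩
    have h3 := measureReal_mono h1 (μ := volume)
      (measure_ne_top_of_subset h2 measure_Ioc_lt_top.ne)
    have h4 := measureReal_mono h2 (μ := volume) measure_Ioc_lt_top.ne
    rw [Real.volume_real_Ioo_of_le (pseudoInv_nonneg f t)] at h3
    rw [Real.volume_real_Ioc_of_le (pseudoInv_nonneg f t)] at h4
    linarith
  rw [setIntegral_congr_fun measurableSet_Ioi (fun t ht => key t ht)]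
  refine (setIntegral_eq_of_subset_of_forall_sdiff_eq_zero measurableSet_Ioi Ioc_subset_Ioi_self
    fun t ht => pseudoInv_eq_zero fun x hx => ?_).symm
  have : 1 < t := by
    by_contra! hc
    exact ht.2 ⟨ht.1, hc⟩
  exact (hm hx).2.trans_lt this

/-! ### Regularity of the iterates -/

/-- The regularity shared by all iterates `h n`, `n ≥ 1`. -/
structure IsProfile (f : ℝ → ℝ) : Prop where
  cont : Continuous f
  anti : StrictAntiOn f (Icc 0 1)
  zero : f 0 = 1
  eq_zero : ∀ x, 1 ≤ x → f x = 0

namespace IsProfile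

theorem mapsTo (hf : IsProfile f) : MapsTo f (Icc 0 1) (Icc 0 1) := by
  intro x hx
  have h0 := hf.anti.antitoneOn (left_mem_Icc.2 zero_le_one) hx hx.1
  have h1 := hf.anti.antitoneOn hx (right_mem_Icc.2 zero_le_one) hx.2
  rw [hf.zero] at h0
  rw [hf.eq_zero 1 le_rfl] at h1
  exact ⟨h1, h0⟩

theorem mapsTo_Ioo (hf : IsProfile f) : MapsTo f (Ioo 0 1) (Ioo 0 1) := by
  intro x hx
  have h0 := hf.anti (left_mem_Icc.2 zero_le_one) (Ioo_subset_Icc_self hx) hx.1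
  have h1 := hf.anti (Ioo_subset_Icc_self hx) (right_mem_Icc.2 zero_le_one) hx.2
  rw [hf.zero] at h0
  rw [hf.eq_zero 1 le_rfl] at h1
  exact ⟨h1, h0⟩

theorem nonneg (hf : IsProfile f) {x : ℝ} (hx : 0 ≤ x) : 0 ≤ f x := by
  rcases le_total x 1 with h | h
  · exact (hf.mapsTo ⟨hx, h⟩).1
  · exact (hf.eq_zero x h).ge

theorem le_one (hf : IsProfile f) {x : ℝ} (hx : 0 ≤ x) : f x ≤ 1 := by
  rcases le_total x 1 with h | h
  · exact (hf.mapsTo ⟨hx, h⟩).2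
  · exact (hf.eq_zero x h).le.trans zero_le_one

theorem pseudoInv_apply (hf : IsProfile f) {x : ℝ} (hx : x ∈ Icc (0 : ℝ) 1) :
    pseudoInv f (f x) = x := by
  refine le_antisymm ?_ (le_pseudoInv hx le_rfl)
  by_contra! hc
  obtain ⟨v, hv1, hv2⟩ := exists_between hc
  have h1 := le_of_lt_pseudoInv hf.anti.antitoneOn (hx.1.trans hv1.le) hv2
  exact (hf.anti hx ⟨hx.1.trans hv1.le, hv2.le.trans (pseudoInv_le_one _ _)⟩ hv1).not_ge h1

theorem pseudoInv_zero (hf : IsProfile f) : pseudoInv f 0 = 1 := by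
  have := hf.pseudoInv_apply (right_mem_Icc.2 zero_le_one)
  rwa [hf.eq_zero 1 le_rfl] at this

theorem pseudoInv_eq_zero (hf : IsProfile f) {y : ℝ} (hy : 1 ≤ y) : pseudoInv f y = 0 := by
  refine le_antisymm ?_ (pseudoInv_nonneg f y)
  refine (pseudoInv_antitone f hy).trans ?_
  have := hf.pseudoInv_apply (left_mem_Icc.2 zero_le_one)
  rw [hf.zero] at this
  exact this.le

theorem surjOn_Ioo (hf : IsProfile f) : SurjOn f (Ioo 0 1) (Ioo 0 1) := by
  have := intermediate_value_Ioo' (zero_le_one' ℝ) hf.cont.continuousOn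
  rwa [hf.zero, hf.eq_zero 1 le_rfl] at this

theorem pseudoInv_pos (hf : IsProfile f) {y : ℝ} (hy : y ∈ Ioo (0 : ℝ) 1) :
    0 < pseudoInv f y := by
  obtain ⟨x, hx, rfl⟩ := hf.surjOn_Ioo hy
  rw [hf.pseudoInv_apply (Ioo_subset_Icc_self hx)]
  exact hx.1

theorem continuousAt_pseudoInv (hf : IsProfile f) {y : ℝ} (hy : y ∈ Ioo (0 : ℝ) 1) :
    ContinuousAt (pseudoInv f) y := by
  have : ContinuousAt (fun t => -pseudoInv f t) y := by
    refine continuousAt_of_monotoneOn_of_image_mem_nhds (s := Ioo 0 1)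
      (fun a _ b _ hab => neg_le_neg (pseudoInv_antitone f hab)) (Ioo_mem_nhds hy.1 hy.2) ?_
    obtain ⟨x, hx, rfl⟩ := hf.surjOn_Ioo hy
    rw [hf.pseudoInv_apply (Ioo_subset_Icc_self hx)]
    refine mem_of_superset (Ioo_mem_nhds (neg_lt_neg hx.2) (neg_lt_zero.2 hx.1)) fun v hv => ?_
    have hv' : -v ∈ Ioo (0 : ℝ) 1 := ⟨by linarith [hv.2], by linarith [hv.1]⟩
    exact ⟨f (-v), hf.mapsTo_Ioo hv', by
      simp only [hf.pseudoInv_apply (Ioo_subset_Icc_self hv'), neg_neg]⟩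
  exact this.neg.congr (Eventually.of_forall fun t => neg_neg _)

theorem integral_pos (hf : IsProfile f) : 0 < ∫ t in (0 : ℝ)..1, f t :=
  intervalIntegral.intervalIntegral_pos_of_pos_on (hf.cont.intervalIntegrable _ _)
    (fun _ hx => (hf.mapsTo_Ioo hx).1) zero_lt_one

end IsProfile

theorem T_sub (f : ℝ → ℝ) (u v : ℝ) :
    T f u - T f v = (∫ t in u..v, pseudoInv f t) / ∫ t in (0 : ℝ)..1, f t := by
  rw [T, T, ← sub_div, ← intervalIntegral.integral_add_adjacent_intervals
    (pseudoInv_intervalIntegrable f u v) (pseudoInv_intervalIntegrable f v 1), add_sub_cancel_right]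

theorem continuous_T (f : ℝ → ℝ) : Continuous (T f) := by
  have := intervalIntegral.continuous_primitive (pseudoInv_intervalIntegrable f) 1
  have h2 := this.neg.div_const (∫ t in (0 : ℝ)..1, f t)
  refine h2.congr fun x => ?_
  rw [T, intervalIntegral.integral_symm 1 x, Pi.neg_apply]

theorem IsProfile.hasDerivAt_T (hf : IsProfile f) {x : ℝ} (hx : x ∈ Ioo (0 : ℝ) 1) :
    HasDerivAt (T f) (-pseudoInv f x / ∫ t in (0 : ℝ)..1, f t) x :=
  (intervalIntegral.integral_hasDerivAt_left (pseudoInv_intervalIntegrable f x 1)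
    (pseudoInv_antitone f).measurable.stronglyMeasurable.stronglyMeasurableAtFilter
    (hf.continuousAt_pseudoInv hx)).div_const _

theorem T_eq_zero (hf : ∀ y, 1 < y → pseudoInv f y = 0) {x : ℝ} (hx : 1 ≤ x) : T f x = 0 := by
  rw [T, intervalIntegral.integral_symm, intervalIntegral.integral_of_le hx,
    setIntegral_congr_fun measurableSet_Ioc (fun t ht => hf t ht.1)]
  simp

theorem IsProfile.T (hf : IsProfile f) : IsProfile (T f) where
  cont := continuous_T f
  anti := by
    refine strictAntiOn_of_deriv_neg (convex_Icc 0 1) (continuous_T f).continuousOn ?_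
    rw [interior_Icc]
    intro x hx
    rw [(hf.hasDerivAt_T hx).deriv, neg_div, neg_lt_zero]
    exact div_pos (hf.pseudoInv_pos hx) hf.integral_pos
  zero := by
    rw [_root_.T, integral_pseudoInv hf.anti.antitoneOn hf.mapsTo, div_self hf.integral_pos.ne']
  eq_zero _ hx := T_eq_zero (fun _ hy => hf.pseudoInv_eq_zero hy.le) hx

theorem pseudoInv_h_zero {y : ℝ} (hy : y ≤ 1) : pseudoInv (h 0) y = 1 :=
  le_antisymm (pseudoInv_le_one _ _) (le_pseudoInv (right_mem_Icc.2 zero_le_one) hy)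

theorem pseudoInv_h_zero_of_lt {y : ℝ} (hy : 1 < y) : pseudoInv (h 0) y = 0 :=
  pseudoInv_eq_zero fun _ _ => hy

theorem κ_zero : κ 0 = 1 := by simp [κ, h]

theorem h_one {x : ℝ} (hx : x ≤ 1) : h 1 x = 1 - x := by
  have h0 : ∫ t in (0 : ℝ)..1, h 0 t = 1 := κ_zero
  change T (h 0) x = _
  rw [T, h0, div_one, intervalIntegral.integral_of_le hx,
    setIntegral_congr_fun measurableSet_Ioc (fun t ht => pseudoInv_h_zero ht.2)]
  simp [hx]

theorem isProfile_h (n : ℕ) : IsProfile (h (n + 1)) := by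
  induction n with
  | zero =>
    refine ⟨continuous_T _, fun x hx y hy hxy => ?_, by simp [h_one],
      fun x hx => T_eq_zero (fun y hy => pseudoInv_h_zero_of_lt hy) hx⟩
    rw [zero_add, h_one hx.2, h_one hy.2]
    linarith
  | succ n ih => exact ih.T

theorem κ_pos (n : ℕ) : 0 < κ n := by
  cases n with
  | zero => rw [κ_zero]; exact one_pos
  | succ n => exact (isProfile_h n).integral_pos

theorem hasDerivAt_h (n : ℕ) {x : ℝ} (hx : x ∈ Ioo (0 : ℝ) 1) :
    HasDerivAt (h (n + 2)) (-pseudoInv (h (n + 1)) x / κ (n + 1)) x :=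
  (isProfile_h n).hasDerivAt_T hx

theorem κ_mul_κ (n : ℕ) :
    κ (n + 1) * κ (n + 2) = ∫ t in (0 : ℝ)..1, t * pseudoInv (h (n + 1)) t := by
  have hF := isProfile_h (n + 1)
  have hint : IntervalIntegrable (fun t => t * pseudoInv (h (n + 1)) t) volume 0 1 :=
    (pseudoInv_intervalIntegrable _ 0 1).continuousOn_mul continuousOn_id
  have key := intervalIntegral.integral_eq_sub_of_hasDerivAt_of_le (zero_le_one' ℝ)
    (f := fun x => x * h (n + 2) x)
    (f' := fun x => h (n + 2) x - (κ (n + 1))⁻¹ * (x * pseudoInv (h (n + 1)) x))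
    (continuous_id.mul hF.cont).continuousOn
    (fun x hx => ((hasDerivAt_id x).mul (hasDerivAt_h n hx)).congr_deriv (by
      simp only [id]; ring))
    ((hF.cont.intervalIntegrable _ _).sub (hint.const_mul _))
  rw [intervalIntegral.integral_sub (hF.cont.intervalIntegrable _ _) (hint.const_mul _),
    intervalIntegral.integral_const_mul, hF.eq_zero 1 le_rfl] at key
  have hk := (κ_pos (n + 1)).ne'
  change κ (n + 2) - _ = _ at key
  field_simp at key
  linarith

/-! ### Sign patterns of pairs of antitone functions -/

/-- No dilate `a * f (c * ·)` crosses `g` with the sign pattern `-, +, -` on `(0, ∞)`. -/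
def NoCross (f g : ℝ → ℝ) : Prop :=
  ∀ ⦃a c x y z : ℝ⦄, 0 < a → 0 < c → 0 < x → x < y → y < z →
    a * f (c * x) < g x → g y < a * f (c * y) → a * f (c * z) < g z → False

theorem exists_pseudoInv_lt (hf : 0 < ∫ t in (0 : ℝ)..1, f t) (hg : 0 < ∫ t in (0 : ℝ)..1, g t)
    {a c u v : ℝ} (hc : 0 < c) (huv : u ≤ v)
    (h : a * T f (c * u) - T g u < a * T f (c * v) - T g v) :
    ∃ t ∈ Icc u v, a * c * (∫ t in (0 : ℝ)..1, g t) / (∫ t in (0 : ℝ)..1, f t) *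
      pseudoInv f (c * t) < pseudoInv g t := by
  by_contra! hn
  set I := ∫ t in (0 : ℝ)..1, f t
  set J := ∫ t in (0 : ℝ)..1, g t
  have hi : IntervalIntegrable (fun t => pseudoInv f (c * t)) volume u v :=
    Antitone.intervalIntegrable fun x y hxy =>
      pseudoInv_antitone f (mul_le_mul_of_nonneg_left hxy hc.le)
  have h1 := intervalIntegral.integral_mono_on (μ := volume) huv (pseudoInv_intervalIntegrable g u v)
    (hi.const_mul _) hn
  rw [intervalIntegral.integral_const_mul, intervalIntegral.integral_comp_mul_left _ hc.ne',
    smul_eq_mul] at h1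
  have h2 := T_sub f (c * u) (c * v)
  have h3 := T_sub g u v
  rw [eq_div_iff hf.ne'] at h2
  rw [eq_div_iff hg.ne'] at h3
  rw [← h2, ← h3] at h1
  have h4 : a * c * J / I * (c⁻¹ * ((T f (c * u) - T f (c * v)) * I)) =
      a * (T f (c * u) - T f (c * v)) * J := by
    field_simp
  rw [h4] at h1
  have := le_of_mul_le_mul_right h1 hg
  linarith

theorem exists_lt_pseudoInv (hf : 0 < ∫ t in (0 : ℝ)..1, f t) (hg : 0 < ∫ t in (0 : ℝ)..1, g t)
    {a c u v : ℝ} (hc : 0 < c) (huv : u ≤ v)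
    (h : a * T f (c * v) - T g v < a * T f (c * u) - T g u) :
    ∃ t ∈ Icc u v, pseudoInv g t < a * c * (∫ t in (0 : ℝ)..1, g t) / (∫ t in (0 : ℝ)..1, f t) *
      pseudoInv f (c * t) := by
  by_contra! hn
  set I := ∫ t in (0 : ℝ)..1, f t
  set J := ∫ t in (0 : ℝ)..1, g t
  have hi : IntervalIntegrable (fun t => pseudoInv f (c * t)) volume u v :=
    Antitone.intervalIntegrable fun x y hxy =>
      pseudoInv_antitone f (mul_le_mul_of_nonneg_left hxy hc.le)
  have h1 := intervalIntegral.integral_mono_on (μ := volume) huv (hi.const_mul _)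
    (pseudoInv_intervalIntegrable g u v) hn
  rw [intervalIntegral.integral_const_mul, intervalIntegral.integral_comp_mul_left _ hc.ne',
    smul_eq_mul] at h1
  have h2 := T_sub f (c * u) (c * v)
  have h3 := T_sub g u v
  rw [eq_div_iff hf.ne'] at h2
  rw [eq_div_iff hg.ne'] at h3
  rw [← h2, ← h3] at h1
  have h4 : a * c * J / I * (c⁻¹ * ((T f (c * u) - T f (c * v)) * I)) =
      a * (T f (c * u) - T f (c * v)) * J := by
    field_simp
  rw [h4] at h1
  have := le_of_mul_le_mul_right h1 hg
  linarith

theorem NoCross.T (hf : 0 < ∫ t in (0 : ℝ)..1, f t) (hg : 0 < ∫ t in (0 : ℝ)..1, g t)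
    (hf1 : ∀ y, 1 < y → pseudoInv f y = 0) (hg1 : ∀ y, 1 < y → pseudoInv g y = 0)
    (H : NoCross (pseudoInv f) (pseudoInv g)) : NoCross (T f) (T g) := by
  intro a c x y z ha hc hx hxy hyz h1 h2 h3
  have hw1 : 1 ≤ max z (max 1 c⁻¹) := (le_max_left _ _).trans (le_max_right _ _)
  have hw2 : 1 ≤ c * max z (max 1 c⁻¹) := by
    have : c⁻¹ ≤ max z (max 1 c⁻¹) := (le_max_right _ _).trans (le_max_right _ _)
    calc 1 = c * c⁻¹ := (mul_inv_cancel₀ hc.ne').symm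
      _ ≤ _ := mul_le_mul_of_nonneg_left this hc.le
  obtain ⟨t₁, ht₁, hd₁⟩ := exists_pseudoInv_lt hf hg (a := a) hc hxy.le (by linarith)
  obtain ⟨t₂, ht₂, hd₂⟩ := exists_lt_pseudoInv hf hg (a := a) hc hyz.le (by linarith)
  obtain ⟨t₃, ht₃, hd₃⟩ := exists_pseudoInv_lt hf hg (a := a) hc (le_max_left z (max 1 c⁻¹)) (by
    rw [T_eq_zero hf1 hw2, T_eq_zero hg1 hw1]; linarith)
  have h12 : t₁ < t₂ := (ht₁.2.trans ht₂.1).lt_of_ne fun h => by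
    rw [h] at hd₁; exact lt_asymm hd₁ hd₂
  have h23 : t₂ < t₃ := (ht₂.2.trans ht₃.1).lt_of_ne fun h => by
    rw [h] at hd₂; exact lt_asymm hd₂ hd₃
  exact H (div_pos (mul_pos (mul_pos ha hc) hg) hf) hc (hx.trans_le ht₁.1) h12 h23 hd₁ hd₂ hd₃

theorem IsProfile.lt_of_pseudoInv_lt (hf : IsProfile f) {u y : ℝ} (hu : 0 ≤ u) (hy : 0 < y)
    (h : pseudoInv f y < u) : f u < y := by
  rcases le_total u 1 with hu1 | hu1
  · exact Stribolic.lt_of_pseudoInv_lt ⟨hu, hu1⟩ h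
  · rwa [hf.eq_zero u hu1]

theorem IsProfile.le_of_lt_pseudoInv (hf : IsProfile f) {u y : ℝ} (hu : 0 ≤ u)
    (h : u < pseudoInv f y) : y ≤ f u :=
  Stribolic.le_of_lt_pseudoInv hf.anti.antitoneOn hu h

theorem NoCross.pseudoInv (hf : IsProfile f) (hg : IsProfile g) (H : NoCross f g) :
    NoCross (pseudoInv f) (pseudoInv g) := by
  intro a c x y z ha hc hx hxy hyz h1 h2 h3
  have hy := hx.trans hxy
  have hz := hy.trans hyz
  obtain ⟨u₁, hl₁, hr₁⟩ := exists_between h1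
  obtain ⟨u₂, hl₂, hr₂⟩ := exists_between h2
  obtain ⟨u₃, hl₃, hr₃⟩ := exists_between h3
  have hu₃ : 0 < u₃ := (mul_nonneg ha.le (pseudoInv_nonneg f _)).trans_lt hl₃
  have h32 : u₃ < u₂ := hr₃.trans ((pseudoInv_antitone g hyz.le).trans_lt hl₂)
  have h21 : u₂ < u₁ := hr₂.trans ((mul_le_mul_of_nonneg_left (pseudoInv_antitone f
    (mul_le_mul_of_nonneg_left hxy.le hc.le)) ha.le).trans_lt hl₁)
  have neg : ∀ {u x : ℝ}, 0 < x → 0 < u → a * _root_.pseudoInv f (c * x) < u →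
      u < _root_.pseudoInv g x → c⁻¹ * f (a⁻¹ * u) < g u := by
    intro u x hx hu hl hr
    refine lt_of_lt_of_le ?_ (hg.le_of_lt_pseudoInv hu.le hr)
    rw [inv_mul_lt_iff₀ hc]
    refine hf.lt_of_pseudoInv_lt (by positivity) (mul_pos hc hx) ?_
    rwa [lt_inv_mul_iff₀ ha]
  refine H (inv_pos.2 hc) (inv_pos.2 ha) hu₃ h32 h21 (neg hz hu₃ hl₃ hr₃) ?_
    (neg hx (hu₃.trans (h32.trans h21)) hl₁ hr₁)
  refine (hg.lt_of_pseudoInv_lt (hu₃.trans h32).le hy hl₂).trans_le ?_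
  rw [le_inv_mul_iff₀ hc]
  refine hf.le_of_lt_pseudoInv (by have := hu₃.trans h32; positivity) ?_
  rwa [inv_mul_lt_iff₀ ha]

theorem pseudoInv_h_of_one_lt (n : ℕ) {y : ℝ} (hy : 1 < y) : pseudoInv (h n) y = 0 := by
  cases n with
  | zero => exact pseudoInv_h_zero_of_lt hy
  | succ n => exact (isProfile_h n).pseudoInv_eq_zero hy.le

theorem noCross_pseudoInv_h (n : ℕ) : NoCross (pseudoInv (h (n + 1))) (pseudoInv (h n)) := by
  induction n with
  | zero =>
    intro a c x y z ha hc hx hxy hyz h1 h2 h3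
    have hz : z ≤ 1 := by
      by_contra! hz
      rw [pseudoInv_h_zero_of_lt hz] at h3
      exact h3.not_ge (mul_nonneg ha.le (pseudoInv_nonneg _ _))
    rw [pseudoInv_h_zero (by linarith)] at h1 h2
    exact (h2.trans_le (mul_le_mul_of_nonneg_left (pseudoInv_antitone _
      (mul_le_mul_of_nonneg_left hxy.le hc.le)) ha.le)).not_gt h1
  | succ n ih =>
    exact NoCross.pseudoInv (isProfile_h (n + 1)) (isProfile_h n) (ih.T (κ_pos (n + 1)) (κ_pos n)
      (fun _ => pseudoInv_h_of_one_lt _) (fun _ => pseudoInv_h_of_one_lt _))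

theorem noCross_h (n : ℕ) : NoCross (h (n + 2)) (h (n + 1)) :=
  (noCross_pseudoInv_h n).T (κ_pos (n + 1)) (κ_pos n)
      (fun _ => pseudoInv_h_of_one_lt _) (fun _ => pseudoInv_h_of_one_lt _)

/-! ### Monotonicity properties of `κ` -/

theorem NoCross.le (hf : IsProfile f) (hg : IsProfile g) (H : NoCross f g) {x : ℝ}
    (hx : x ∈ Icc (0 : ℝ) 1) : f x ≤ g x := by
  rcases hx.1.eq_or_lt with rfl | hx0
  · rw [hf.zero, hg.zero]
  rcases hx.2.eq_or_lt with rfl | hx1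
  · rw [hf.eq_zero 1 le_rfl, hg.eq_zero 1 le_rfl]
  by_contra! hlt
  have ht : Tendsto (fun c : ℝ => c⁻¹ * f (c * x)) (𝓝 1) (𝓝 (1⁻¹ * f (1 * x))) := by
    refine ContinuousAt.mul (continuousAt_inv₀ one_ne_zero) ?_
    exact (hf.cont.comp (continuous_id.mul continuous_const)).continuousAt
  rw [inv_one, one_mul, one_mul] at ht
  obtain ⟨c, hc, hc1⟩ := (((ht.eventually_const_lt hlt).filter_mono
    (nhdsWithin_le_nhds (s := Ioi 1))).and self_mem_nhdsWithin).exists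
  have hc1 : 1 < c := hc1
  have hc0 := one_pos.trans hc1
  have hcinv : c⁻¹ < 1 := inv_lt_one_of_one_lt₀ hc1
  have hg0 : ∀ᶠ u in 𝓝[>] (0 : ℝ), c⁻¹ < g u :=
    (hg.cont.continuousAt.eventually_const_lt (by rwa [hg.zero])).filter_mono nhdsWithin_le_nhds
  obtain ⟨u, hu, hu0, hux⟩ := (hg0.and (Ioo_mem_nhdsGT hx0)).exists
  obtain ⟨z, hz, hz1⟩ := exists_between (max_lt hx1 hcinv)
  have hxz := (le_max_left _ _).trans_lt hz
  have hcz : 1 ≤ c * z := by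
    have := ((le_max_right _ _).trans_lt hz).le
    rwa [inv_le_iff_one_le_mul₀' hc0] at this
  refine H (inv_pos.2 hc0) hc0 hu0 hux hxz ?_ hc ?_
  · refine lt_of_le_of_lt ?_ hu
    exact mul_le_of_le_one_right (inv_pos.2 hc0).le (hf.le_one (by positivity))
  · rw [hf.eq_zero _ hcz, mul_zero]
    exact (hg.mapsTo_Ioo ⟨hx0.trans hxz, hz1⟩).1

theorem κ_antitone : Antitone κ := by
  refine antitone_nat_of_succ_le fun n => ?_
  cases n with
  | zero =>
    rw [κ_zero]
    have := intervalIntegral.integral_mono_on (μ := volume) (zero_le_one' ℝ)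
      ((isProfile_h 0).cont.intervalIntegrable 0 1)
      (intervalIntegrable_const (c := (1 : ℝ)))
      (fun x hx => ((isProfile_h 0).mapsTo hx).2)
    simpa [κ] using this
  | succ n =>
    exact intervalIntegral.integral_mono_on (μ := volume) (zero_le_one' ℝ)
      ((isProfile_h _).cont.intervalIntegrable 0 1) ((isProfile_h _).cont.intervalIntegrable 0 1)
      (fun x hx => (noCross_h n).le (isProfile_h _) (isProfile_h _) hx)

theorem le_pseudoInv_h_nhds_zero (n : ℕ) {b : ℝ} (hb : b < 1) :
    ∀ᶠ t in 𝓝[>] (0 : ℝ), b < pseudoInv (h n) t := by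
  obtain ⟨v, hv, hv1⟩ := exists_between (max_lt hb one_pos)
  have hbv := (le_max_left _ _).trans_lt hv
  have hv0 := (le_max_right _ _).trans_lt hv
  have hpos : 0 < h n v := by
    cases n with
    | zero => exact one_pos
    | succ n => exact ((isProfile_h n).mapsTo_Ioo ⟨hv0, hv1⟩).1
  filter_upwards [Ioo_mem_nhdsGT hpos] with t ht
  exact hbv.trans_le (le_pseudoInv ⟨hv0.le, hv1.le⟩ ht.2.le)

/-- Up to the factor `κ (n + 1) / κ n`, the iterate `h (n + 2)` is a stretched `h (n + 1)`. -/
theorem h_le_h_mul (n : ℕ) {c : ℝ} (hc : 0 < c) (hcn : c < κ (n + 1) / κ n) {x : ℝ}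
    (hx : x ∈ Icc (0 : ℝ) 1) : h (n + 1) x ≤ h (n + 2) (c * x) := by
  by_contra! hlt
  have hF := isProfile_h (n + 1)
  have hG := isProfile_h n
  have hk := κ_pos n
  have hk1 := κ_pos (n + 1)
  have hs : 1 * c * κ n / κ (n + 1) < 1 := by
    rw [lt_div_iff₀ hk] at hcn
    rwa [div_lt_one hk1, one_mul]
  have hs0 : 0 ≤ 1 * c * κ n / κ (n + 1) := by positivity
  have small : ∀ᶠ t in 𝓝[>] (0 : ℝ), 1 * c * κ n / κ (n + 1) * pseudoInv (h (n + 1)) (c * t) <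
      pseudoInv (h n) t := by
    filter_upwards [le_pseudoInv_h_nhds_zero n hs] with t ht
    exact (mul_le_of_le_one_right hs0 (pseudoInv_le_one _ _)).trans_lt ht
  obtain ⟨t₂, ht₂, hd₂⟩ := exists_lt_pseudoInv (f := h (n + 1)) (g := h n) (a := 1) hk1 hk hc hx.1
    (by
      change 1 * h (n + 2) _ - h (n + 1) _ < 1 * h (n + 2) _ - h (n + 1) _
      rw [mul_zero, hF.zero, hG.zero]; linarith)
  obtain ⟨t₃, ht₃, hd₃⟩ := exists_pseudoInv_lt (f := h (n + 1)) (g := h n) (a := 1) hk1 hk hc hx.2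
    (by
      change 1 * h (n + 2) _ - h (n + 1) _ < 1 * h (n + 2) _ - h (n + 1) _
      have := hF.nonneg (x := c * 1) (by positivity)
      rw [hG.eq_zero 1 le_rfl]; linarith)
  have h23 : t₂ < t₃ := (ht₂.2.trans ht₃.1).lt_of_ne fun h => by
    rw [h] at hd₂; exact lt_asymm hd₂ hd₃
  have h2 : 0 < t₂ := ht₂.1.lt_of_ne fun h0 => by
    rw [← h0, mul_zero, (isProfile_h n).pseudoInv_zero] at hd₂
    have : pseudoInv (h n) 0 = 1 := by
      cases n with
      | zero => exact pseudoInv_h_zero zero_le_one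
      | succ n => exact (isProfile_h n).pseudoInv_zero
    rw [this, mul_one] at hd₂
    exact lt_asymm hd₂ hs
  obtain ⟨t₁, hd₁, ht₁⟩ := (small.and (Ioo_mem_nhdsGT h2)).exists
  exact noCross_pseudoInv_h n (by positivity) hc ht₁.1 ht₁.2 h23 hd₁ hd₂ hd₃

theorem mul_pseudoInv_h_le (n : ℕ) {c : ℝ} (hc : 0 < c) (hcn : c < κ (n + 1) / κ n) (y : ℝ) :
    c * pseudoInv (h (n + 1)) y ≤ pseudoInv (h (n + 2)) y := by
  rw [← le_div_iff₀' hc]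
  have hc1 : c ≤ 1 := hcn.le.trans (div_le_one_of_le₀ (κ_antitone n.le_succ) (κ_pos n).le)
  refine Real.sSup_le (fun x hx => ?_) (div_nonneg (pseudoInv_nonneg _ _) hc.le)
  rw [le_div_iff₀' hc]
  exact le_pseudoInv ⟨mul_nonneg hc.le hx.1.1, mul_le_one₀ hc1 hx.1.1 hx.1.2⟩
    (hx.2.trans (h_le_h_mul n hc hcn hx.1))

theorem κ_mul_κ_le (n : ℕ) : κ (n + 1) / κ n * (κ (n + 1) * κ (n + 2)) ≤ κ (n + 2) * κ (n + 3) := by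
  have hk : 0 < κ (n + 1) * κ (n + 2) := mul_pos (κ_pos _) (κ_pos _)
  rw [← le_div_iff₀ hk]
  refine le_of_forall_lt_imp_le_of_dense fun c hcn => ?_
  rw [le_div_iff₀ hk]
  rcases le_or_gt c 0 with hc | hc
  · exact (mul_nonpos_of_nonpos_of_nonneg hc hk.le).trans (mul_pos (κ_pos _) (κ_pos _)).le
  rw [κ_mul_κ, κ_mul_κ, ← intervalIntegral.integral_const_mul]
  have hint : ∀ m, IntervalIntegrable (fun t => t * pseudoInv (h m) t) volume 0 1 := fun m =>
    (pseudoInv_intervalIntegrable _ 0 1).continuousOn_mul continuousOn_id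
  refine intervalIntegral.integral_mono_on (μ := volume) zero_le_one ((hint _).const_mul _) (hint _)
    fun x hx => ?_
  have := mul_le_mul_of_nonneg_left (mul_pseudoInv_h_le n hc hcn x) hx.1
  linarith

theorem monotone_κ_ratio : Monotone fun n => κ (n + 2) * κ (n + 1) / κ n := by
  refine monotone_nat_of_le_succ fun n => ?_
  have h0 := κ_pos n
  have h1 := κ_pos (n + 1)
  rw [le_div_iff₀ h1]
  refine le_trans (le_of_eq ?_) ((κ_mul_κ_le n).trans_eq (mul_comm _ _))
  ring

theorem le_κ (n m : ℕ) (hn : κ (n + 2) * κ (n + 1) / κ n ≤ κ (n + 1)) :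
    κ (n + 2) * κ (n + 1) / κ n ≤ κ m := by
  rcases le_or_gt m (n + 1) with hm | hm
  · exact hn.trans (κ_antitone hm)
  · obtain ⟨k, rfl⟩ := Nat.exists_eq_add_of_lt hm
    refine (monotone_κ_ratio (show n ≤ n + k by lia)).trans ?_
    have e : n + 1 + k + 1 = n + k + 2 := by ring
    rw [e]
    exact (div_le_iff₀ (κ_pos _)).2
      (mul_le_mul_of_nonneg_left (κ_antitone (Nat.le_succ _)) (κ_pos _).le)

/-! ### The compositions `q n` satisfy the recursion -/

/-- A differentiable antitone self-map of `[0, 1]` exchanging the endpoints. -/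
structure Decreasing (A A' : ℝ → ℝ) : Prop where
  anti : AntitoneOn A (Icc 0 1)
  cont : ContinuousOn A (Icc 0 1)
  zero : A 0 = 1
  one : A 1 = 0
  mapsTo : MapsTo A (Ioo 0 1) (Ioo 0 1)
  deriv : ∀ x ∈ Ioo (0 : ℝ) 1, HasDerivAt A (A' x) x
  nonpos : ∀ x ∈ Ioo (0 : ℝ) 1, A' x ≤ 0

theorem exists_hasDerivAt_h (n : ℕ) {x : ℝ} (hx : x ∈ Ioo (0 : ℝ) 1) :
    HasDerivAt (h (n + 1)) (deriv (h (n + 1)) x) x ∧ deriv (h (n + 1)) x ≤ 0 := by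
  cases n with
  | zero =>
    have : HasDerivAt (h 1) (-1) x := by
      refine ((hasDerivAt_id x).const_sub 1).congr_of_eventuallyEq ?_
      filter_upwards [Iio_mem_nhds hx.2] with y hy using h_one hy.le
    rw [zero_add, this.deriv]
    exact ⟨this, by norm_num⟩
  | succ n =>
    have := hasDerivAt_h n hx
    rw [this.deriv]
    exact ⟨this, div_nonpos_of_nonpos_of_nonneg (neg_nonpos.2 (pseudoInv_nonneg _ _)) (κ_pos _).le⟩

namespace Decreasing

variable {A A' : ℝ → ℝ}

theorem mapsTo_Icc (hA : Decreasing A A') : MapsTo A (Icc 0 1) (Icc 0 1) := by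
  intro x hx
  have h0 := hA.anti (left_mem_Icc.2 zero_le_one) hx hx.1
  have h1 := hA.anti hx (right_mem_Icc.2 zero_le_one) hx.2
  rw [hA.zero] at h0
  rw [hA.one] at h1
  exact ⟨h1, h0⟩

theorem hasDerivAt_h_comp (hA : Decreasing A A') (n : ℕ) {x : ℝ} (hx : x ∈ Ioo (0 : ℝ) 1) :
    HasDerivAt (h (n + 1) ∘ A) (_root_.deriv (h (n + 1)) (A x) * A' x) x :=
  (exists_hasDerivAt_h n (hA.mapsTo hx)).1.comp x (hA.deriv x hx)

theorem h_comp_nonneg (hA : Decreasing A A') (n : ℕ) {x : ℝ} (hx : x ∈ Ioo (0 : ℝ) 1) :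
    0 ≤ _root_.deriv (h (n + 1)) (A x) * A' x :=
  mul_nonneg_of_nonpos_of_nonpos (exists_hasDerivAt_h n (hA.mapsTo hx)).2 (hA.nonpos x hx)

theorem stepData (hA : Decreasing A A') (n : ℕ) :
    StepData A (h (n + 1) ∘ A) (h (n + 2) ∘ h (n + 1) ∘ A)
      (fun x => _root_.deriv (h (n + 1)) (A x) * A' x) (κ (n + 1)) where
  pos := κ_pos _
  anti := hA.anti
  mapsA := hA.mapsTo_Icc
  mapsB := (isProfile_h n).mapsTo.comp hA.mapsTo_Icc
  mapsC := (isProfile_h (n + 1)).mapsTo.comp ((isProfile_h n).mapsTo.comp hA.mapsTo_Icc)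
  contB := (isProfile_h n).cont.comp_continuousOn hA.cont
  contC := (isProfile_h (n + 1)).cont.comp_continuousOn
    ((isProfile_h n).cont.comp_continuousOn hA.cont)
  B0 := by simp [hA.zero, (isProfile_h n).eq_zero]
  C0 := by simp [hA.zero, (isProfile_h n).eq_zero, (isProfile_h (n + 1)).zero]
  C1 := by simp [hA.one, (isProfile_h n).zero, (isProfile_h (n + 1)).eq_zero]
  derivB x hx := hA.hasDerivAt_h_comp n hx
  derivC x hx := by
    have h1 := (hasDerivAt_h n ((isProfile_h n).mapsTo_Ioo (hA.mapsTo hx))).comp x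
      (hA.hasDerivAt_h_comp n hx)
    rw [(isProfile_h n).pseudoInv_apply (Ioo_subset_Icc_self (hA.mapsTo hx))] at h1
    exact h1.congr_deriv (by ring)
  nonneg x hx := hA.h_comp_nonneg n hx

theorem h_comp_one_sub (hA : Decreasing A A') (n : ℕ) :
    Decreasing (fun x => h (n + 1) (A (1 - x)))
      (fun x => -(_root_.deriv (h (n + 1)) (A (1 - x)) * A' (1 - x))) where
  anti x hx y hy hxy := (isProfile_h n).anti.antitoneOn (hA.mapsTo_Icc (by grind))
    (hA.mapsTo_Icc (by grind)) (hA.anti (by grind) (by grind) (by linarith))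
  cont := (isProfile_h n).cont.comp_continuousOn
    (hA.cont.comp (by fun_prop) fun x hx => by grind)
  zero := by simp [hA.one, (isProfile_h n).zero]
  one := by simp [hA.zero, (isProfile_h n).eq_zero]
  mapsTo x hx := (isProfile_h n).mapsTo_Ioo (hA.mapsTo (by grind))
  deriv x hx := by
    have h1 := (hA.hasDerivAt_h_comp n (x := 1 - x) (by grind)).comp x
      ((hasDerivAt_id x).const_sub 1)
    exact h1.congr_deriv (by ring)
  nonpos x hx := neg_nonpos.2 (hA.h_comp_nonneg n (by grind))

end Decreasing

theorem exists_decreasing_q (n : ℕ) : ∃ A', Decreasing (q n ∘ CoeffTree.flip n.bodd) A' := by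
  induction n with
  | zero =>
    refine ⟨fun _ => -1, ?_⟩
    have e : q 0 ∘ CoeffTree.flip (Nat.bodd 0) = fun x => 1 - x := rfl
    rw [e]
    exact
      { anti := fun x _ y _ hxy => by dsimp only; linarith
        cont := by fun_prop
        zero := sub_zero 1
        one := sub_self 1
        mapsTo := fun x hx => by grind
        deriv := fun x _ => (hasDerivAt_id x).const_sub 1
        nonpos := fun _ _ => by norm_num }
  | succ n ih =>
    obtain ⟨A', hA⟩ := ih
    refine ⟨_, cast (congrArg₂ Decreasing ?_ rfl) (hA.h_comp_one_sub n)⟩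
    funext x
    simp only [q, Function.comp, Nat.bodd_succ]
    cases n.bodd <;> simp [CoeffTree.flip]

theorem stepData_q (n : ℕ) :
    ∃ D, StepData (q n ∘ CoeffTree.flip n.bodd) (q (n + 1) ∘ CoeffTree.flip n.bodd) (q (n + 2) ∘ CoeffTree.flip n.bodd)
      D (κ (n + 1)) :=
  let ⟨_, hA⟩ := exists_decreasing_q n
  ⟨_, hA.stepData n⟩

theorem run_certs : CoeffTree.run certs false CoeffTree.start = true := by
  decide +kernel

theorem abs_κ_sub_le (i : ℕ) (hi : i < certs.length) :
    |κ (i + 1) - certs[i].K / CoeffTree.one| ≤ certs[i].G / CoeffTree.one := by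
  choose D hD using stepData_q
  have := CoeffTree.run_sound (p := q) (c := fun n => κ (n + 1)) (D := D) (par := Nat.bodd)
    Nat.bodd_succ hD certs 0 CoeffTree.start run_certs
    (CoeffTree.inv_start (fun _ _ => rfl) fun x hx => h_one hx.2) i hi
  simpa using this

theorem κ_22_mem : κ 22 ∈ Icc 0.2788770614387032 0.2788770614387034 := by
  have h := abs_le.1 (abs_κ_sub_le 21 (by decide))
  simp only [certs, CoeffTree.one_eq, List.getElem_cons_succ, List.getElem_cons_zero] at h
  norm_num at h ⊢
  constructor <;> linarith [h.1, h.2]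

theorem κ_23_mem : κ 23 ∈ Icc 0.2788770613940221 0.2788770613940228 := by
  have h := abs_le.1 (abs_κ_sub_le 22 (by decide))
  simp only [certs, CoeffTree.one_eq, List.getElem_cons_succ, List.getElem_cons_zero] at h
  norm_num at h ⊢
  constructor <;> linarith [h.1, h.2]

theorem κ_24_mem : κ 24 ∈ Icc 0.278877061377969 0.278877061377975 := by
  have h := abs_le.1 (abs_κ_sub_le 23 (by decide))
  simp only [certs, CoeffTree.one_eq, List.getElem_cons_succ, List.getElem_cons_zero] at h
  norm_num at h ⊢
  constructor <;> linarith [h.1, h.2]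

end Stribolic

/-- Rational bounds on the stribolic constant κ = inf_n κ n. -/
theorem stmt19 :
    0.2788770612338 < κ 23 - 1 + κ 23 / κ 22 ∧
    κ 23 - 1 + κ 23 / κ 22 < (⨅ n : ℕ, κ n) ∧
    (⨅ n : ℕ, κ n) < κ 23 ∧
    κ 23 < 0.2788770613941 := by
  obtain ⟨l22, u22⟩ := Stribolic.κ_22_mem
  obtain ⟨l23, u23⟩ := Stribolic.κ_23_mem
  obtain ⟨l24, u24⟩ := Stribolic.κ_24_mem
  have h22 := Stribolic.κ_pos 22
  have hr : κ 23 / κ 22 * κ 22 = κ 23 := div_mul_cancel₀ _ h22.ne'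
  have hr0 : 0 < κ 23 / κ 22 := div_pos (Stribolic.κ_pos 23) h22
  set r := κ 23 / κ 22 with hrdef
  have hlow : 1 - 0.000000000160219 < r := by
    rw [hrdef, lt_div_iff₀ h22]; norm_num at *; linarith
  have hup : r < 1 - 0.00000000016021 := by
    rw [hrdef, div_lt_iff₀ h22]; norm_num at *; linarith
  have hL : κ 24 * κ 23 / κ 22 = κ 24 * r := by rw [mul_div_assoc]
  refine ⟨by norm_num at *; linarith, ?_, ?_, by norm_num at *; linarith⟩
  · have hle : κ 24 * r ≤ ⨅ n : ℕ, κ n := by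
      refine le_ciInf fun m => ?_
      rw [← hL]
      refine Stribolic.le_κ 22 m ?_
      rw [hL]
      norm_num at *
      nlinarith
    refine lt_of_lt_of_le ?_ hle
    norm_num at *
    nlinarith
  · have : (⨅ n : ℕ, κ n) ≤ κ 24 :=
      ciInf_le ⟨0, forall_mem_range.2 fun n => (Stribolic.κ_pos n).le⟩ 24
    norm_num at *
    linarith
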